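/- Let F be a finite field of cardinality q. If q is odd, then the projective special linear group PSL(4,F) has at least one string C-group representation of rank 4. If q is even, then PSL(4,F) has no string C-group representation of any rank. -/

import Mathlib

/-- A string C-group representation of rank `n` of a group `G`: a family of `n`
involutions generating `G`, satisfying the commuting (string) property and the
intersection property. -/
def IsStringCGroupRep {G : Type*} [Group G] {n : ℕ} (ρ : Fin n → G) : Prop :=
  (∀ i, orderOf (ρ i) = 2) ∧
  Subgroup.closure (Set.range ρ) = ⊤ ∧
  (∀ i j : Fin n, i.val + 1 < j.val → Commute (ρ i) (ρ j)) ∧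
  (∀ I J : Set (Fin n),
    Subgroup.closure (ρ '' I) ⊓ Subgroup.closure (ρ '' J) = Subgroup.closure (ρ '' (I ∩ J)))

namespace PSLFour

section Transvections

open Matrix
open Matrix.SpecialLinearGroup (diag2n diag2n_coe diagonal_transvection_induction')

theorem one_add_single_mul_eq_diagonal {ι F : Type*} [Fintype ι] [DecidableEq ι] [Field F]
    {i j : ι} (hij : i ≠ j) {c : F} (hc : c ≠ 0) :
    (1 + single i j c) * (1 + single j i (-c⁻¹)) * (1 + single i j (c - 1)) *
      (1 + single j i 1) * (1 + single i j (-1)) =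
    diagonal fun k => if k = i then c else if k = j then c⁻¹ else 1 := by
  have hd : (diagonal fun k => if k = i then c else if k = j then c⁻¹ else 1) =
      1 + single i i (c - 1) + single j j (c⁻¹ - 1) := by
    ext k l
    simp only [diagonal_apply, Matrix.add_apply, one_apply, single_apply]
    grind
  have hs (a b : ι) (x : F) : single a b x = x • single a b (1 : F) := by simp
  rw [hd, hs i j c, hs j i (-c⁻¹), hs i j (c - 1), hs i j (-1), hs i i (c - 1), hs j j (c⁻¹ - 1)]
  simp only [mul_add, add_mul, one_mul, mul_one, single_mul_single_same, smul_mul_assoc,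
    mul_smul_comm, single_mul_single_of_ne _ _ _ _ hij, single_mul_single_of_ne _ _ _ _ hij.symm,
    add_zero, smul_zero]
  match_scalars <;> field_simp <;> ring

theorem subgroup_eq_top_of_transvection_mem {ι F : Type*} [Fintype ι] [DecidableEq ι]
    [Nontrivial ι] [Field F] (H : Subgroup (Matrix.SpecialLinearGroup ι F))
    (hH : ∀ (i j : ι) (hij : i ≠ j) (c : F), Matrix.SpecialLinearGroup.transvection hij c ∈ H) :
    H = ⊤ := by
  refine eq_top_iff.2 fun M _ => ?_
  refine diagonal_transvection_induction' (fun g => g ∈ H) M (fun i j hij c hc => ?_)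
    hH (fun A B hA hB => H.mul_mem hA hB)
  have key : Matrix.SpecialLinearGroup.transvection hij c *
      Matrix.SpecialLinearGroup.transvection hij.symm (-c⁻¹) *
      Matrix.SpecialLinearGroup.transvection hij (c - 1) *
      Matrix.SpecialLinearGroup.transvection hij.symm 1 *
      Matrix.SpecialLinearGroup.transvection hij (-1) = diag2n hij c hc :=
    Subtype.ext (one_add_single_mul_eq_diagonal hij hc)
  rw [← key]
  exact H.mul_mem (H.mul_mem (H.mul_mem (H.mul_mem (hH ..) (hH ..)) (hH ..)) (hH ..)) (hH ..)

end Transvections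

section Projective

open Matrix
variable {F : Type*} [Field F]

theorem center_le_of_smul_one_mem {K : Subgroup (Matrix.SpecialLinearGroup (Fin 4) F)}
    (hK : ∀ (z : Matrix.SpecialLinearGroup (Fin 4) F) (c : F), c ^ 4 = 1 →
      (z : Matrix (Fin 4) (Fin 4) F) = c • 1 → z ∈ K) :
    Subgroup.center (Matrix.SpecialLinearGroup (Fin 4) F) ≤ K := by
  intro z hz
  obtain ⟨c, hc, h⟩ := Matrix.SpecialLinearGroup.mem_center_iff.1 hz
  exact hK z c (by simpa using hc) (by rw [← h, Matrix.scalar_apply, smul_one_eq_diagonal])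

theorem mk_eq_mk_of_coe_eq_smul {g h : Matrix.SpecialLinearGroup (Fin 4) F} (c : F)
    (hgh : (g : Matrix (Fin 4) (Fin 4) F) = c • (h : Matrix (Fin 4) (Fin 4) F)) :
    (g : Matrix.ProjectiveSpecialLinearGroup (Fin 4) F) = h := by
  have hc : c ^ 4 = 1 := by
    have := congrArg Matrix.det hgh
    rw [Matrix.det_smul, g.2, h.2] at this
    simpa using this.symm
  refine QuotientGroup.eq.2 (Matrix.SpecialLinearGroup.mem_center_iff.2 ⟨c⁻¹, by simp [hc], ?_⟩)
  have hc0 : c ≠ 0 := by rintro rfl; simp at hc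
  have : (h : Matrix (Fin 4) (Fin 4) F) = c⁻¹ • (g : Matrix (Fin 4) (Fin 4) F) := by
    rw [hgh, smul_smul, inv_mul_cancel₀ hc0, one_smul]
  rw [Matrix.SpecialLinearGroup.coe_mul, this, mul_smul_comm, ← Matrix.SpecialLinearGroup.coe_mul,
    inv_mul_cancel, Matrix.scalar_apply, ← smul_one_eq_diagonal, Matrix.SpecialLinearGroup.coe_one]

theorem coe_eq_smul_of_mk_eq_mk {g h : Matrix.SpecialLinearGroup (Fin 4) F}
    (hgh : (g : Matrix.ProjectiveSpecialLinearGroup (Fin 4) F) = h) :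
    ∃ c : F, (h : Matrix (Fin 4) (Fin 4) F) = c • (g : Matrix (Fin 4) (Fin 4) F) := by
  obtain ⟨c, -, h1⟩ := Matrix.SpecialLinearGroup.mem_center_iff.1 (QuotientGroup.eq.1 hgh)
  refine ⟨c, ?_⟩
  have h2 : h = g * (g⁻¹ * h) := by group
  rw [h2, Matrix.SpecialLinearGroup.coe_mul, ← h1, Matrix.scalar_apply, ← smul_one_eq_diagonal,
    mul_smul_comm, mul_one]

theorem mem_of_mk_mem_closure {n : ℕ} {r : Fin n → Matrix.SpecialLinearGroup (Fin 4) F}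
    {K : Subgroup (Matrix.SpecialLinearGroup (Fin 4) F)}
    (hK : Subgroup.center (Matrix.SpecialLinearGroup (Fin 4) F) ≤ K) {I : Set (Fin n)}
    (hI : ∀ i ∈ I, r i ∈ K) {g : Matrix.SpecialLinearGroup (Fin 4) F}
    (hg : (g : Matrix.ProjectiveSpecialLinearGroup (Fin 4) F) ∈ Subgroup.closure
      ((fun i => (r i : Matrix.ProjectiveSpecialLinearGroup (Fin 4) F)) '' I)) : g ∈ K := by
  have h : Subgroup.closure ((fun i => (r i : Matrix.ProjectiveSpecialLinearGroup (Fin 4) F)) '' I)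
      ≤ K.map (QuotientGroup.mk' _) := by
    rw [Subgroup.closure_le]
    rintro _ ⟨i, hi, rfl⟩
    exact ⟨r i, hI i hi, rfl⟩
  obtain ⟨k, hk, hkg⟩ := h hg
  have : k⁻¹ * g ∈ K := hK (QuotientGroup.eq.1 hkg)
  simpa using K.mul_mem hk this

theorem exists_mem_closure_of_mk_mem_closure {n : ℕ}
    {r : Fin n → Matrix.SpecialLinearGroup (Fin 4) F} {I : Set (Fin n)}
    {x : Matrix.ProjectiveSpecialLinearGroup (Fin 4) F}
    (hx : x ∈ Subgroup.closure
      ((fun i => (r i : Matrix.ProjectiveSpecialLinearGroup (Fin 4) F)) '' I)) :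
    ∃ g ∈ Subgroup.closure (r '' I), (g : Matrix.ProjectiveSpecialLinearGroup (Fin 4) F) = x := by
  have h : (fun i => (r i : Matrix.ProjectiveSpecialLinearGroup (Fin 4) F)) '' I =
      QuotientGroup.mk' (Subgroup.center (Matrix.SpecialLinearGroup (Fin 4) F)) '' (r '' I) := by
    rw [Set.image_image]; rfl
  rw [h, ← MonoidHom.map_closure] at hx
  exact hx

theorem mk_mem_closure {n : ℕ}
    {r : Fin n → Matrix.SpecialLinearGroup (Fin 4) F} {I : Set (Fin n)}
    {g : Matrix.SpecialLinearGroup (Fin 4) F} (hg : g ∈ Subgroup.closure (r '' I)) :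
    (g : Matrix.ProjectiveSpecialLinearGroup (Fin 4) F) ∈ Subgroup.closure
      ((fun i => (r i : Matrix.ProjectiveSpecialLinearGroup (Fin 4) F)) '' I) := by
  have h : (fun i => (r i : Matrix.ProjectiveSpecialLinearGroup (Fin 4) F)) '' I =
      QuotientGroup.mk' (Subgroup.center (Matrix.SpecialLinearGroup (Fin 4) F)) '' (r '' I) := by
    rw [Set.image_image]; rfl
  rw [h, ← MonoidHom.map_closure]
  exact ⟨g, hg, rfl⟩

/-- The stabilizer in `SL(4, F)` of the line spanned by `v`. -/
def lineStabilizer (v : Fin 4 → F) : Subgroup (Matrix.SpecialLinearGroup (Fin 4) F) where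
  carrier := {g | ∃ c : F, (g : Matrix (Fin 4) (Fin 4) F) *ᵥ v = c • v}
  one_mem' := ⟨1, by simp⟩
  mul_mem' := by
    rintro g h ⟨c, hc⟩ ⟨d, hd⟩
    exact ⟨d * c, by
      rw [Matrix.SpecialLinearGroup.coe_mul, ← mulVec_mulVec, hd, mulVec_smul, hc, smul_smul]⟩
  inv_mem' := by
    rintro g ⟨c, hc⟩
    have h : v = c • ((g⁻¹ : Matrix.SpecialLinearGroup (Fin 4) F) : Matrix _ _ F) *ᵥ v := by
      rw [← mulVec_smul, ← hc, mulVec_mulVec, ← Matrix.SpecialLinearGroup.coe_mul]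
      simp
    by_cases h0 : c = 0
    · rw [h0, zero_smul] at h
      exact ⟨0, by simp [h]⟩
    · refine ⟨c⁻¹, ?_⟩
      nth_rw 2 [h]
      rw [smul_smul, inv_mul_cancel₀ h0, one_smul]

theorem center_le_lineStabilizer (v : Fin 4 → F) :
    Subgroup.center (Matrix.SpecialLinearGroup (Fin 4) F) ≤ lineStabilizer v :=
  center_le_of_smul_one_mem fun z c _ hz => ⟨c, by rw [hz, smul_mulVec, one_mulVec]⟩

/-- The elements of `SL(4, F)` preserving the bilinear form with matrix `ω` up to sign. -/
def signedIsometries (ω : Matrix (Fin 4) (Fin 4) F) :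
    Subgroup (Matrix.SpecialLinearGroup (Fin 4) F) where
  carrier := {g | ∃ s : F, s * s = 1 ∧
    (g : Matrix (Fin 4) (Fin 4) F)ᵀ * ω * (g : Matrix (Fin 4) (Fin 4) F) = s • ω}
  one_mem' := ⟨1, by simp⟩
  mul_mem' := by
    rintro g h ⟨s, hs, hg⟩ ⟨t, ht, hh⟩
    refine ⟨s * t, by linear_combination t * t * hs + ht, ?_⟩
    rw [Matrix.SpecialLinearGroup.coe_mul, transpose_mul,
      show ∀ A B C D : Matrix (Fin 4) (Fin 4) F, A * B * ω * (C * D) = A * (B * ω * C) * D from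
        fun A B C D => by simp only [Matrix.mul_assoc], hg, mul_smul_comm, smul_mul_assoc, hh,
      smul_smul]
  inv_mem' := by
    rintro g ⟨s, hs, hg⟩
    refine ⟨s, hs, ?_⟩
    have h1 : (g : Matrix (Fin 4) (Fin 4) F) *
        ((g⁻¹ : Matrix.SpecialLinearGroup (Fin 4) F) : Matrix _ _ F) = 1 := by
      rw [← Matrix.SpecialLinearGroup.coe_mul, mul_inv_cancel, Matrix.SpecialLinearGroup.coe_one]
    have h2 : (((g⁻¹ : Matrix.SpecialLinearGroup (Fin 4) F) : Matrix _ _ F))ᵀ *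
        (g : Matrix (Fin 4) (Fin 4) F)ᵀ = 1 := by
      rw [← transpose_mul, h1, transpose_one]
    have h3 : ω = s • ((g : Matrix (Fin 4) (Fin 4) F)ᵀ * ω * (g : Matrix (Fin 4) (Fin 4) F)) := by
      rw [hg, smul_smul, hs, one_smul]
    nth_rw 1 [h3]
    rw [mul_smul_comm, smul_mul_assoc]
    congr 1
    rw [show ∀ A B C D : Matrix (Fin 4) (Fin 4) F, A * (B * ω * C) * D = A * B * ω * (C * D) from
        fun A B C D => by simp only [Matrix.mul_assoc], h2, h1, Matrix.one_mul, Matrix.mul_one]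

theorem center_le_signedIsometries (ω : Matrix (Fin 4) (Fin 4) F) :
    Subgroup.center (Matrix.SpecialLinearGroup (Fin 4) F) ≤ signedIsometries ω :=
  center_le_of_smul_one_mem fun z c hc hz => ⟨c * c, by linear_combination hc, by
    rw [hz, transpose_smul, transpose_one, smul_mul_assoc, one_mul, mul_smul_comm, mul_one,
      smul_smul]⟩

end Projective

section Generators

open Matrix
variable {F : Type*} [Field F]

/-- Matrices of determinant one whose images generate `PSL(4, F)` in odd characteristic,
as soon as `l` generates the multiplicative group of `F`. -/
def genMatrix (l : Fˣ) : Fin 4 → Matrix (Fin 4) (Fin 4) F :=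
  ![!![0, 0, 0, -(l : F)⁻¹; 0, 0, 1, 0; 0, -1, 0, 0; (l : F), 0, 0, 0],
    !![1, 1, 0, 0; 0, -1, 0, 0; 0, 0, 0, 1; 0, 0, 1, 0],
    !![1, 0, 0, 0; 0, 0, 1, 0; 0, 1, 0, 0; 0, 0, 0, -1],
    !![1, 0, 0, 0; 0, 1, 0, 0; 0, 0, -1, 0; 0, 0, 0, -1]]

theorem det_genMatrix (l : Fˣ) (i : Fin 4) : (genMatrix l i).det = 1 := by
  fin_cases i <;>
    simp [genMatrix, Matrix.det_succ_row_zero, Fin.sum_univ_succ,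
      show Fin.succAbove (3 : Fin 4) (2 : Fin 3) = 2 from rfl, show (-1 : F) ^ 3 = -1 by ring]

/-- The elements of `SL(4, F)` with matrices `genMatrix l`. -/
def gen (l : Fˣ) (i : Fin 4) : Matrix.SpecialLinearGroup (Fin 4) F :=
  ⟨genMatrix l i, det_genMatrix l i⟩

theorem coe_gen (l : Fˣ) (i : Fin 4) : (gen l i : Matrix (Fin 4) (Fin 4) F) = genMatrix l i := rfl

/-- The image of `gen l i` in `PSL(4, F)`. -/
def pgen (l : Fˣ) (i : Fin 4) : Matrix.ProjectiveSpecialLinearGroup (Fin 4) F :=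
  (gen l i : Matrix.ProjectiveSpecialLinearGroup (Fin 4) F)

theorem genMatrix_zero_mul_self (l : Fˣ) : genMatrix l 0 * genMatrix l 0 = -1 := by
  ext a b
  fin_cases a <;> fin_cases b <;> simp [genMatrix, Matrix.mul_apply, Fin.sum_univ_four]

theorem genMatrix_mul_self (l : Fˣ) {i : Fin 4} (hi : i ≠ 0) :
    genMatrix l i * genMatrix l i = 1 := by
  fin_cases i
  · exact absurd rfl hi
  all_goals
    ext a b
    fin_cases a <;> fin_cases b <;> simp [genMatrix, Matrix.mul_apply, Fin.sum_univ_four]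

theorem gen_mul_self (l : Fˣ) {i : Fin 4} (hi : i ≠ 0) : gen l i * gen l i = 1 :=
  Subtype.ext (genMatrix_mul_self l hi)

theorem genMatrix_mul_of_lt (l : Fˣ) (i j : Fin 4) (hij : i.val + 1 < j.val) :
    ∃ c : F, genMatrix l i * genMatrix l j = c • (genMatrix l j * genMatrix l i) := by
  have : (i = 0 ∧ j = 2) ∨ (i = 0 ∧ j = 3) ∨ (i = 1 ∧ j = 3) := by
    revert i j; decide
  rcases this with ⟨rfl, rfl⟩ | ⟨rfl, rfl⟩ | ⟨rfl, rfl⟩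
  on_goal 1 => use -1
  on_goal 2 => use -1
  on_goal 3 => use 1
  all_goals
    ext a b
    fin_cases a <;> fin_cases b <;> simp [genMatrix, Matrix.mul_apply, Fin.sum_univ_four]

theorem pgen_mul_self (l : Fˣ) (i : Fin 4) : pgen l i * pgen l i = 1 := by
  by_cases hi : i = 0
  · subst hi
    refine mk_eq_mk_of_coe_eq_smul (g := gen l 0 * gen l 0) (h := 1) (-1) ?_
    rw [Matrix.SpecialLinearGroup.coe_mul, coe_gen, genMatrix_zero_mul_self,
      Matrix.SpecialLinearGroup.coe_one, neg_one_smul]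
  · rw [pgen, ← QuotientGroup.mk_mul, gen_mul_self l hi, QuotientGroup.mk_one]

theorem pgen_commute (l : Fˣ) (i j : Fin 4) (hij : i.val + 1 < j.val) :
    Commute (pgen l i) (pgen l j) := by
  obtain ⟨c, hc⟩ := genMatrix_mul_of_lt l i j hij
  exact mk_eq_mk_of_coe_eq_smul (g := gen l i * gen l j) (h := gen l j * gen l i) c hc

theorem pgen_ne_one [NeZero (2 : F)] (l : Fˣ) (i : Fin 4) : pgen l i ≠ 1 := by
  intro h
  obtain ⟨c, hc⟩ := coe_eq_smul_of_mk_eq_mk (g := 1) (h := gen l i) h.symm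
  rw [coe_gen, Matrix.SpecialLinearGroup.coe_one] at hc
  have h2 : (2 : F) ≠ 0 := NeZero.ne _
  fin_cases i
  · simpa [genMatrix] using congrFun (congrFun hc 1) 2
  · simpa [genMatrix] using congrFun (congrFun hc 2) 3
  · simpa [genMatrix] using congrFun (congrFun hc 1) 2
  · have h0 := congrFun (congrFun hc 0) 0
    have h3 := congrFun (congrFun hc 3) 3
    simp [genMatrix] at h0 h3
    exact h2 (by linear_combination h0 - h3)

theorem orderOf_pgen [NeZero (2 : F)] (l : Fˣ) (i : Fin 4) : orderOf (pgen l i) = 2 :=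
  orderOf_eq_prime (by rw [pow_two, pgen_mul_self]) (pgen_ne_one l i)

end Generators

section Generation

open Matrix
variable {F : Type*} [Field F]

/-- The subgroup `H` contains the elementary matrix `1 + t E_{ij}`. -/
def HasElementary (H : Subgroup (Matrix.SpecialLinearGroup (Fin 4) F)) (i j : Fin 4) (t : F) :
    Prop :=
  ∃ g ∈ H, (g : Matrix (Fin 4) (Fin 4) F) = 1 + single i j t

namespace HasElementary

variable {H : Subgroup (Matrix.SpecialLinearGroup (Fin 4) F)} {i j k : Fin 4} {s t : F}

theorem transvection_mem (hij : i ≠ j) (h : HasElementary H i j t) :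
    Matrix.SpecialLinearGroup.transvection hij t ∈ H := by
  obtain ⟨g, hg, h⟩ := h
  have : Matrix.SpecialLinearGroup.transvection hij t = g := Subtype.ext h.symm
  rwa [this]

theorem of_transvection_mem (hij : i ≠ j)
    (h : Matrix.SpecialLinearGroup.transvection hij t ∈ H) : HasElementary H i j t :=
  ⟨_, h, rfl⟩

theorem zero : HasElementary H i j 0 := ⟨1, H.one_mem, by simp⟩

theorem add (hij : i ≠ j) (hs : HasElementary H i j s) (ht : HasElementary H i j t) :
    HasElementary H i j (s + t) := by
  refine of_transvection_mem hij ?_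
  rw [Matrix.SpecialLinearGroup.transvection_add]
  exact H.mul_mem (hs.transvection_mem hij) (ht.transvection_mem hij)

theorem neg (hij : i ≠ j) (ht : HasElementary H i j t) : HasElementary H i j (-t) := by
  refine of_transvection_mem hij ?_
  rw [← Matrix.SpecialLinearGroup.transvection_inv]
  exact H.inv_mem (ht.transvection_mem hij)

theorem nsmul (hij : i ≠ j) (ht : HasElementary H i j t) (n : ℕ) :
    HasElementary H i j (n * t) := by
  induction n with
  | zero => simpa using zero
  | succ n ih =>
    rw [Nat.cast_succ, add_one_mul]
    exact ih.add hij ht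

theorem mul (hij : i ≠ j) (hjk : j ≠ k) (hik : i ≠ k) (hs : HasElementary H i j s)
    (ht : HasElementary H j k t) : HasElementary H i k (s * t) := by
  refine ⟨_, H.mul_mem (H.mul_mem (hs.transvection_mem hij) (ht.transvection_mem hjk))
    (H.mul_mem ((hs.neg hij).transvection_mem hij) ((ht.neg hjk).transvection_mem hjk)), ?_⟩
  simp only [Matrix.SpecialLinearGroup.coe_mul, Matrix.SpecialLinearGroup.transvection_coe,
    mul_add, add_mul, one_mul, mul_one, single_mul_single_same,
    single_mul_single_of_ne _ _ _ _ hij.symm, single_mul_single_of_ne _ _ _ _ hjk.symm,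
    single_mul_single_of_ne _ _ _ _ hik.symm, add_zero]
  simp only [mul_neg, neg_mul, ← Matrix.single_neg, neg_neg]
  abel

theorem conj {g : Matrix.SpecialLinearGroup (Fin 4) F} (hg : g ∈ H) {i' j' : Fin 4} {t' : F}
    (h : (g : Matrix (Fin 4) (Fin 4) F) * single i j t = single i' j' t' * g)
    (ht : HasElementary H i j t) : HasElementary H i' j' t' := by
  obtain ⟨x, hx, hxt⟩ := ht
  refine ⟨g * x * g⁻¹, H.mul_mem (H.mul_mem hg hx) (H.inv_mem hg), ?_⟩
  rw [Matrix.SpecialLinearGroup.coe_mul, Matrix.SpecialLinearGroup.coe_mul, hxt, mul_add, h,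
    mul_one, ← one_add_mul, Matrix.mul_assoc, ← Matrix.SpecialLinearGroup.coe_mul,
    mul_inv_cancel, Matrix.SpecialLinearGroup.coe_one, mul_one]

end HasElementary

theorem hasElementary_neg_two (l : Fˣ) :
    HasElementary (Subgroup.closure (Set.range (gen l))) 0 1 (-2) := by
  have hm (i : Fin 4) : gen l i ∈ Subgroup.closure (Set.range (gen l)) :=
    Subgroup.subset_closure ⟨i, rfl⟩
  have h23 := Subgroup.mul_mem _ (hm 2) (hm 3)
  refine ⟨gen l 1 * (gen l 2 * gen l 3 * (gen l 2 * gen l 3)) * gen l 1 *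
    (gen l 3 * (gen l 2 * gen l 3 * (gen l 2 * gen l 3))),
    Subgroup.mul_mem _ (Subgroup.mul_mem _ (Subgroup.mul_mem _ (hm 1)
      (Subgroup.mul_mem _ h23 h23)) (hm 1))
      (Subgroup.mul_mem _ (hm 3) (Subgroup.mul_mem _ h23 h23)), ?_⟩
  have e23 : genMatrix l 2 * genMatrix l 3 * (genMatrix l 2 * genMatrix l 3) =
      !![1, 0, 0, 0; 0, -1, 0, 0; 0, 0, -1, 0; 0, 0, 0, 1] := by
    ext a b
    fin_cases a <;> fin_cases b <;> simp [genMatrix, Matrix.mul_apply, Fin.sum_univ_four]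
  simp only [Matrix.SpecialLinearGroup.coe_mul, coe_gen, e23]
  ext a b
  fin_cases a <;> fin_cases b <;>
    simp [genMatrix, Matrix.mul_apply, Fin.sum_univ_four]
  norm_num

theorem genMatrix_conj (l : Fˣ) (t : F) :
    (genMatrix l 2 * single 0 1 t = single 0 2 t * genMatrix l 2) ∧
    (genMatrix l 1 * single 0 2 t = single 0 3 t * genMatrix l 1) ∧
    (genMatrix l 1 * single 0 3 t = single 0 2 t * genMatrix l 1) ∧
    (genMatrix l 0 * single 0 1 t = single 3 2 (-(l * t)) * genMatrix l 0) ∧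
    (genMatrix l 0 * single 0 2 t = single 3 1 (l * t) * genMatrix l 0) ∧
    (genMatrix l 0 * single 0 3 t = single 3 0 (-(l * (l * t))) * genMatrix l 0) ∧
    (genMatrix l 1 * single 3 2 t = single 2 3 t * genMatrix l 1) ∧
    (genMatrix l 1 * single 3 1 t = single 2 1 (-t) * genMatrix l 1) ∧
    (genMatrix l 2 * single 2 3 t = single 1 3 (-t) * genMatrix l 2) ∧
    (genMatrix l 2 * single 2 1 t = single 1 2 t * genMatrix l 2) := by
  refine ⟨?_, ?_, ?_, ?_, ?_, ?_, ?_, ?_, ?_, ?_⟩ <;>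
  · ext a b
    fin_cases a <;> fin_cases b <;>
      simp [genMatrix, Matrix.mul_apply, single_apply, mul_comm] <;> field_simp

theorem closure_gen_eq_top [Fintype F] (hF : Odd (Fintype.card F)) {l : Fˣ}
    (hl : ∀ x : Fˣ, x ∈ Subgroup.zpowers l) : Subgroup.closure (Set.range (gen l)) = ⊤ := by
  set H := Subgroup.closure (Set.range (gen l)) with hH
  have hm (i : Fin 4) : gen l i ∈ H := Subgroup.subset_closure ⟨i, rfl⟩
  have h01 : HasElementary H 0 1 (1 : F) := by
    obtain ⟨k, hk⟩ := hF
    have h := (hasElementary_neg_two l).nsmul (by decide) k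
    have hq : ((Fintype.card F : ℕ) : F) = 0 := Nat.cast_card_eq_zero F
    rw [hk] at hq
    push_cast at hq
    rwa [show (k : F) * -2 = 1 by linear_combination -hq] at h
  have h02 : HasElementary H 0 2 (1 : F) := h01.conj (hm 2) (genMatrix_conj l 1).1
  have h03 : HasElementary H 0 3 (1 : F) := h02.conj (hm 1) (genMatrix_conj l 1).2.1
  have h32 : HasElementary H 3 2 (l : F) := by
    have := (h01.conj (hm 0) (genMatrix_conj l 1).2.2.2.1).neg (by decide)
    simpa using this
  have h31 : HasElementary H 3 1 (l : F) := by
    have := h02.conj (hm 0) (genMatrix_conj l 1).2.2.2.2.1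
    simpa using this
  have h30 : HasElementary H 3 0 ((l : F) * l) := by
    have := (h03.conj (hm 0) (genMatrix_conj l 1).2.2.2.2.2.1).neg (by decide)
    simpa using this
  have h23 : HasElementary H 2 3 (l : F) := h32.conj (hm 1) (genMatrix_conj l l).2.2.2.2.2.2.1
  have h21 : HasElementary H 2 1 (l : F) := by
    have := (h31.conj (hm 1) (genMatrix_conj l l).2.2.2.2.2.2.2.1).neg (by decide)
    simpa using this
  have h13 : HasElementary H 1 3 (l : F) := by
    have := (h23.conj (hm 2) (genMatrix_conj l l).2.2.2.2.2.2.2.2.1).neg (by decide)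
    simpa using this
  have h12 : HasElementary H 1 2 (l : F) := h21.conj (hm 2) (genMatrix_conj l l).2.2.2.2.2.2.2.2.2
  have hpow (k : ℕ) : HasElementary H 0 1 ((l : F) ^ k) ∧ HasElementary H 0 3 ((l : F) ^ k) := by
    induction k with
    | zero => simpa using ⟨h01, h03⟩
    | succ k ih =>
      rw [pow_succ]
      exact ⟨ih.2.mul (by decide) (by decide) (by decide) h31,
        ih.1.mul (by decide) (by decide) (by decide) h13⟩
  have hgen (t : F) (ht : t ≠ 0) : ∃ k : ℕ, (l : F) ^ k = t := by
    obtain ⟨k, hk⟩ := (mem_powers_iff_mem_zpowers (x := l)).2 (hl (Units.mk0 t ht))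
    exact ⟨k, by simpa using congrArg Units.val hk⟩
  have a01 (t : F) : HasElementary H 0 1 t := by
    by_cases ht : t = 0
    · exact ht ▸ .zero
    · obtain ⟨k, rfl⟩ := hgen t ht
      exact (hpow k).1
  have a03 (t : F) : HasElementary H 0 3 t := by
    by_cases ht : t = 0
    · exact ht ▸ .zero
    · obtain ⟨k, rfl⟩ := hgen t ht
      exact (hpow k).2
  have a02 (t : F) : HasElementary H 0 2 t :=
    (a03 t).conj (hm 1) (genMatrix_conj l t).2.2.1
  have a0 (j : Fin 4) (hj : 0 ≠ j) (t : F) : HasElementary H 0 j t := by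
    fin_cases j
    · exact absurd rfl hj
    · exact a01 t
    · exact a02 t
    · exact a03 t
  have hscale {i j k : Fin 4} (hij : i ≠ j) (hjk : j ≠ k) (hik : i ≠ k) {u : F} (hu : u ≠ 0)
      (h : HasElementary H i j u) (ha : ∀ t, HasElementary H j k t) (t : F) :
      HasElementary H i k t := by
    have := h.mul hij hjk hik (ha (u⁻¹ * t))
    rwa [mul_inv_cancel_left₀ hu] at this
  have hl0 : (l : F) ≠ 0 := l.ne_zero
  have h10 : HasElementary H 1 0 ((l : F) * (l * l)) :=
    h13.mul (by decide) (by decide) (by decide) h30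
  have h20 : HasElementary H 2 0 ((l : F) * (l * l)) :=
    h23.mul (by decide) (by decide) (by decide) h30
  have hi0 (i : Fin 4) (hi : i ≠ 0) : ∃ u : F, u ≠ 0 ∧ HasElementary H i 0 u := by
    fin_cases i
    · exact absurd rfl hi
    · exact ⟨_, by simp, h10⟩
    · exact ⟨_, by simp, h20⟩
    · exact ⟨_, by simp, h30⟩
  have aij (i j : Fin 4) (hi : i ≠ 0) (hj : 0 ≠ j) (hij : i ≠ j) (t : F) :
      HasElementary H i j t := by
    obtain ⟨u, hu, h⟩ := hi0 i hi
    exact hscale hi hj hij hu h (a0 j hj) t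
  have ai0 (i : Fin 4) (hi : i ≠ 0) (t : F) : HasElementary H i 0 t := by
    obtain ⟨j, hj, hij⟩ : ∃ j : Fin 4, j ≠ 0 ∧ i ≠ j := by
      revert i; decide
    obtain ⟨u, hu, h⟩ := hi0 j hj
    have := (aij i j hi hj.symm hij (t * u⁻¹)).mul hij hj hi h
    rwa [inv_mul_cancel_right₀ hu] at this
  refine subgroup_eq_top_of_transvection_mem H fun i j hij c => ?_
  refine HasElementary.transvection_mem hij ?_
  by_cases hi : i = 0
  · subst hi
    exact a0 j hij c
  · by_cases hj : j = 0
    · subst hj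
      exact ai0 i hi c
    · exact aij i j hi (Ne.symm hj) hij c

theorem closure_pgen_eq_top [Fintype F] (hF : Odd (Fintype.card F)) {l : Fˣ}
    (hl : ∀ x : Fˣ, x ∈ Subgroup.zpowers l) : Subgroup.closure (Set.range (pgen l)) = ⊤ := by
  refine eq_top_iff.2 fun x _ => ?_
  obtain ⟨g, rfl⟩ := QuotientGroup.mk_surjective x
  rw [← Set.image_univ]
  refine mk_mem_closure (r := gen l) ?_
  rw [Set.image_univ, closure_gen_eq_top hF hl]
  exact Subgroup.mem_top g

end Generation

section StringIntersection

variable {P : Type*} [Group P]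

theorem mem_closure_insert_of_commute {a : P} {S : Set P} (ha : a * a = 1)
    (hS : ∀ s ∈ S, Commute a s) {g : P} (hg : g ∈ Subgroup.closure (insert a S)) :
    ∃ w ∈ Subgroup.closure S, g = w ∨ g = a * w := by
  have hc (w : P) (hw : w ∈ Subgroup.closure S) : Commute a w := by
    have : Subgroup.closure S ≤ Subgroup.centralizer {a} := by
      rw [Subgroup.closure_le]
      exact fun s hs => Subgroup.mem_centralizer_singleton_iff.2 (hS s hs).symm.eq
    exact (Subgroup.mem_centralizer_singleton_iff.1 (this hw)).symm
  have hinv : a⁻¹ = a := inv_eq_of_mul_eq_one_right ha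
  induction hg using Subgroup.closure_induction with
  | mem x hx =>
    rcases hx with rfl | hx
    · exact ⟨1, Subgroup.one_mem _, Or.inr (mul_one _).symm⟩
    · exact ⟨x, Subgroup.subset_closure hx, Or.inl rfl⟩
  | one => exact ⟨1, Subgroup.one_mem _, Or.inl rfl⟩
  | mul x y _ _ hx hy =>
    obtain ⟨w, hw, hx⟩ := hx
    obtain ⟨v, hv, hy⟩ := hy
    refine ⟨w * v, Subgroup.mul_mem _ hw hv, ?_⟩
    rcases hx with rfl | rfl <;> rcases hy with rfl | rfl
    · exact Or.inl rfl
    · exact Or.inr (by rw [← mul_assoc, ← (hc x hw).eq, mul_assoc])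
    · exact Or.inr (by rw [mul_assoc])
    · exact Or.inl (by rw [mul_assoc, ← mul_assoc w, ← (hc w hw).eq, mul_assoc, ← mul_assoc, ha,
        one_mul])
  | inv x _ hx =>
    obtain ⟨w, hw, hx⟩ := hx
    refine ⟨w⁻¹, Subgroup.inv_mem _ hw, ?_⟩
    rcases hx with rfl | rfl
    · exact Or.inl rfl
    · exact Or.inr (by rw [mul_inv_rev, hinv, ((hc w hw).inv_right).eq])

theorem mem_closure_singleton_of_sq {a : P} (ha : a * a = 1) {g : P}
    (hg : g ∈ Subgroup.closure {a}) : g = 1 ∨ g = a := by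
  replace hg : g ∈ Subgroup.closure (insert a ∅) := by rwa [insert_empty_eq]
  obtain ⟨w, hw, h⟩ := mem_closure_insert_of_commute ha (by simp) hg
  rw [Subgroup.closure_empty, Subgroup.mem_bot] at hw
  subst hw
  simpa using h

theorem exists_zpow_of_mem_closure_pair {a b : P} (ha : a * a = 1) (hb : b * b = 1) {g : P}
    (hg : g ∈ Subgroup.closure {a, b}) :
    ∃ k : ℤ, g = (a * b) ^ k ∨ g = (a * b) ^ k * b := by
  have hb' : b⁻¹ = b := inv_eq_of_mul_eq_one_right hb
  have ha' : a⁻¹ = a := inv_eq_of_mul_eq_one_right ha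
  have hbab : b * (a * b) * b⁻¹ = (a * b)⁻¹ := by
    rw [mul_inv_rev, hb', ha', mul_assoc, mul_assoc, hb, mul_one]
  have hconj (k : ℤ) : b * (a * b) ^ k = (a * b) ^ (-k) * b := by
    rw [zpow_neg, ← inv_zpow, ← hbab, conj_zpow]
    group
  have hstep (x : P) (hx : x = a ∨ x = b) (y : P)
      (hy : ∃ k : ℤ, y = (a * b) ^ k ∨ y = (a * b) ^ k * b) :
      ∃ k : ℤ, x * y = (a * b) ^ k ∨ x * y = (a * b) ^ k * b := by
    have hbstep (y : P) (hy : ∃ k : ℤ, y = (a * b) ^ k ∨ y = (a * b) ^ k * b) :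
        ∃ k : ℤ, b * y = (a * b) ^ k ∨ b * y = (a * b) ^ k * b := by
      obtain ⟨k, rfl | rfl⟩ := hy
      · exact ⟨-k, Or.inr (hconj k)⟩
      · exact ⟨-k, Or.inl (by rw [← mul_assoc, hconj, mul_assoc, hb, mul_one])⟩
    rcases hx with rfl | rfl
    · obtain ⟨k, h⟩ := hbstep y hy
      have e : x * y = (x * b) * (b * y) := by
        rw [mul_assoc, ← mul_assoc b, hb, one_mul]
      refine ⟨k + 1, ?_⟩
      rw [e, add_comm, zpow_add, zpow_one]
      rcases h with h | h <;> rw [h]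
      · exact Or.inl rfl
      · exact Or.inr (mul_assoc _ _ _).symm
    · exact hbstep y hy
  induction hg using Subgroup.closure_induction_left with
  | one => exact ⟨0, Or.inl (zpow_zero _).symm⟩
  | mul_left x hx y _ hy => exact hstep x hx y hy
  | inv_mul_cancel x hx y _ hy =>
    refine hstep _ ?_ y hy
    rcases hx with rfl | rfl
    · exact Or.inl ha'
    · exact Or.inr hb'

open Subgroup in
/-- For four involutions with string diagram, the intersection property follows from a few
special cases. -/
theorem intersection_property_of_rank_four {ρ : Fin 4 → P} (hsq : ∀ i, ρ i * ρ i = 1)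
    (hne : ∀ i, ρ i ≠ 1) (hcomm : ∀ i j : Fin 4, i.val + 1 < j.val → Commute (ρ i) (ρ j))
    (htop : closure (Set.range ρ) = ⊤) (h12 : ρ 1 ≠ ρ 2) (h23 : ρ 2 ≠ ρ 3)
    (h0 : ρ 0 ∉ closure (ρ '' {1, 2, 3}))
    (hD : closure (ρ '' {1, 2, 3}) ⊓ closure (ρ '' {0, 1, 2}) ≤ closure (ρ '' {1, 2}))
    (h01D : closure (ρ '' {0, 1}) ⊓ closure (ρ '' {1, 2}) ≤ closure (ρ '' {1}))
    (h23D : closure (ρ '' {2, 3}) ⊓ closure (ρ '' {1, 2}) ≤ closure (ρ '' {2}))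
    (I J : Set (Fin 4)) :
    closure (ρ '' I) ⊓ closure (ρ '' J) = closure (ρ '' (I ∩ J)) := by
  have hmono {A B : Set (Fin 4)} (h : A ⊆ B) : closure (ρ '' A) ≤ closure (ρ '' B) :=
    closure_mono (Set.image_mono h)
  have hmem {A : Set (Fin 4)} {i : Fin 4} (h : i ∈ A) : ρ i ∈ closure (ρ '' A) :=
    subset_closure ⟨i, h, rfl⟩
  have hsingle {i : Fin 4} {g : P} (hg : g ∈ closure (ρ '' {i})) : g = 1 ∨ g = ρ i := by
    rw [Set.image_singleton] at hg
    exact mem_closure_singleton_of_sq (hsq i) hg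
  have hinsert {i : Fin 4} {A : Set (Fin 4)} (h : ∀ j ∈ A, Commute (ρ i) (ρ j)) {g : P}
      (hg : g ∈ closure (ρ '' insert i A)) : ∃ w ∈ closure (ρ '' A), g = w ∨ g = ρ i * w := by
    rw [Set.image_insert_eq] at hg
    refine mem_closure_insert_of_commute (hsq i) ?_ hg
    rintro _ ⟨j, hj, rfl⟩
    exact h j hj
  have c02 := hcomm 0 2 (by decide)
  have c03 := hcomm 0 3 (by decide)
  have c13 := hcomm 1 3 (by decide)
  have s0 {g : P} (hg : g ∈ closure (ρ '' {0, 2, 3})) :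
      ∃ w ∈ closure (ρ '' {2, 3}), g = w ∨ g = ρ 0 * w :=
    hinsert (by simp [c02, c03]) hg
  have s3 {g : P} (hg : g ∈ closure (ρ '' {0, 1, 3})) :
      ∃ w ∈ closure (ρ '' {0, 1}), g = w ∨ g = ρ 3 * w := by
    refine hinsert (by simp [c03.symm, c13.symm]) (hmono ?_ hg)
    intro x; simp; tauto
  have s13 {g : P} (hg : g ∈ closure (ρ '' {1, 3})) :
      ∃ w ∈ closure (ρ '' {3}), g = w ∨ g = ρ 1 * w := hinsert (by simp [c13]) hg
  have n3 : ρ 3 ∉ closure (ρ '' {0, 1, 2}) := by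
    intro h
    have h' := hD ⟨hmem (by simp), h⟩
    rcases hsingle (h23D ⟨hmem (by simp), h'⟩) with h | h
    · exact hne 3 h
    · exact h23 h.symm
  have n1 : ρ 1 ∉ closure (ρ '' {2, 3}) := by
    intro h
    rcases hsingle (h23D ⟨h, hmem (by simp)⟩) with h | h
    · exact hne 1 h
    · exact h12 h
  have m01 {g : P} (h0' : g ∈ closure (ρ '' {1, 2, 3})) (h1 : g ∈ closure (ρ '' {0, 2, 3})) :
      g ∈ closure (ρ '' {2, 3}) := by
    obtain ⟨w, hw, rfl | rfl⟩ := s0 h1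
    · exact hw
    · refine absurd ?_ h0
      have := mul_mem h0' (inv_mem (hmono (B := {1, 2, 3}) (by simp) hw))
      simpa using this
  have m02 {g : P} (h0' : g ∈ closure (ρ '' {1, 2, 3})) (h2 : g ∈ closure (ρ '' {0, 1, 3})) :
      g ∈ closure (ρ '' {1, 3}) := by
    obtain ⟨w, hw, h⟩ := s3 h2
    have hw0 : w ∈ closure (ρ '' {1, 2, 3}) := by
      rcases h with rfl | rfl
      · exact h0'
      · have := mul_mem (inv_mem (hmem (A := {1, 2, 3}) (i := 3) (by simp))) h0'
        simpa using this
    have hw1 : w ∈ closure (ρ '' {1}) :=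
      h01D ⟨hw, hD ⟨hw0, hmono (by intro x; simp; tauto) hw⟩⟩
    have hw13 : w ∈ closure (ρ '' {1, 3}) := hmono (by simp) hw1
    rcases h with rfl | rfl
    · exact hw13
    · exact mul_mem (hmem (by simp)) hw13
  have m13 {g : P} (h1 : g ∈ closure (ρ '' {0, 2, 3})) (h3 : g ∈ closure (ρ '' {0, 1, 2})) :
      g ∈ closure (ρ '' {0, 2}) := by
    obtain ⟨w, hw, h⟩ := s0 h1
    have hw3 : w ∈ closure (ρ '' {0, 1, 2}) := by
      rcases h with rfl | rfl
      · exact h3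
      · have := mul_mem (inv_mem (hmem (A := {0, 1, 2}) (i := 0) (by simp))) h3
        simpa using this
    have hw2 : w ∈ closure (ρ '' {2}) :=
      h23D ⟨hw, hD ⟨hmono (by simp) hw, hw3⟩⟩
    have hw02 : w ∈ closure (ρ '' {0, 2}) := hmono (by simp) hw2
    rcases h with rfl | rfl
    · exact hw02
    · exact mul_mem (hmem (by simp)) hw02
  have m23 {g : P} (h2 : g ∈ closure (ρ '' {0, 1, 3})) (h3 : g ∈ closure (ρ '' {0, 1, 2})) :
      g ∈ closure (ρ '' {0, 1}) := by
    obtain ⟨w, hw, rfl | rfl⟩ := s3 h2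
    · exact hw
    · refine absurd ?_ n3
      have := mul_mem h3 (inv_mem (hmono (B := {0, 1, 2}) (by intro x; simp; tauto) hw))
      simpa using this
  have m12 {g : P} (h1 : g ∈ closure (ρ '' {0, 2, 3})) (h2 : g ∈ closure (ρ '' {0, 1, 3})) :
      g ∈ closure (ρ '' {0, 3}) := by
    obtain ⟨w, hw, hgw⟩ := s0 h1
    obtain ⟨d, hd, hgd⟩ := s3 h2
    have hx : ∃ x ∈ closure (ρ '' {0, 1}), ∃ i : ℕ, w = ρ 3 ^ i * x := by
      have hx0 : (ρ 0)⁻¹ * d ∈ closure (ρ '' {0, 1}) :=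
        mul_mem (inv_mem (hmem (by simp))) hd
      rcases hgw with rfl | rfl <;> rcases hgd with h | h
      · exact ⟨d, hd, 0, by simpa using h⟩
      · exact ⟨d, hd, 1, by simpa using h⟩
      · exact ⟨_, hx0, 0, by simp [← h]⟩
      · exact ⟨_, hx0, 1, by
          rw [pow_one, ← mul_assoc, ← (c03.inv_left).eq, mul_assoc, ← h, inv_mul_cancel_left]⟩
    obtain ⟨x, hx, i, rfl⟩ := hx
    have hx23 : x ∈ closure (ρ '' {2, 3}) := by
      have := mul_mem (inv_mem (pow_mem (hmem (A := {2, 3}) (i := 3) (by simp)) i)) hw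
      simpa using this
    have hxD := hD ⟨hmono (by simp) hx23, hmono (by intro y; simp; tauto) hx⟩
    have hx1 : x = 1 := by
      rcases hsingle (h23D ⟨hx23, hxD⟩) with h | h
      · exact h
      · rcases hsingle (h01D ⟨hx, hxD⟩) with h' | h'
        · exact h'
        · exact absurd (h'.symm.trans h) h12
    subst hx1
    have h3i : ρ 3 ^ i * 1 ∈ closure (ρ '' {0, 3}) := by
      rw [mul_one]
      exact pow_mem (hmem (by simp)) i
    rcases hgw with rfl | rfl
    · exact h3i
    · exact mul_mem (hmem (by simp)) h3i
  have m012 {g : P} (h0' : g ∈ closure (ρ '' {1, 2, 3})) (h1 : g ∈ closure (ρ '' {0, 2, 3}))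
      (h2 : g ∈ closure (ρ '' {0, 1, 3})) : g ∈ closure (ρ '' {3}) := by
    have h23' := m01 h0' h1
    obtain ⟨w, hw, rfl | rfl⟩ := s13 (m02 h0' h2)
    · exact hw
    · refine absurd ?_ n1
      have := mul_mem h23' (inv_mem (hmono (B := {2, 3}) (by simp) hw))
      simpa using this
  have m023 {g : P} (h0' : g ∈ closure (ρ '' {1, 2, 3})) (h2 : g ∈ closure (ρ '' {0, 1, 3}))
      (h3 : g ∈ closure (ρ '' {0, 1, 2})) : g ∈ closure (ρ '' {1}) := by
    have h01 := m23 h2 h3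
    exact h01D ⟨h01, hD ⟨h0', h3⟩⟩
  have m013 {g : P} (h0' : g ∈ closure (ρ '' {1, 2, 3})) (h1 : g ∈ closure (ρ '' {0, 2, 3}))
      (h3 : g ∈ closure (ρ '' {0, 1, 2})) : g ∈ closure (ρ '' {2}) :=
    h23D ⟨m01 h0' h1, hD ⟨h0', h3⟩⟩
  have m123 {g : P} (h1 : g ∈ closure (ρ '' {0, 2, 3})) (h2 : g ∈ closure (ρ '' {0, 1, 3}))
      (h3 : g ∈ closure (ρ '' {0, 1, 2})) : g ∈ closure (ρ '' {0}) := by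
    obtain ⟨w, hw, hgw⟩ := hinsert (A := {3}) (by simp [c03]) (m12 h1 h2)
    have hw3 : w ∈ closure (ρ '' {0, 1, 2}) := by
      rcases hgw with rfl | rfl
      · exact h3
      · have := mul_mem (inv_mem (hmem (A := {0, 1, 2}) (i := 0) (by simp))) h3
        simpa using this
    have hw1 : w = 1 := by
      rcases hsingle hw with h | h
      · exact h
      · exact absurd (h ▸ hw3) n3
    subst hw1
    rcases hgw with rfl | rfl
    · exact one_mem _
    · simp
  have key (A : Set (Fin 4)) (g : P) (hA0 : 0 ∉ A → g ∈ closure (ρ '' {1, 2, 3}))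
      (hA1 : 1 ∉ A → g ∈ closure (ρ '' {0, 2, 3})) (hA2 : 2 ∉ A → g ∈ closure (ρ '' {0, 1, 3}))
      (hA3 : 3 ∉ A → g ∈ closure (ρ '' {0, 1, 2})) : g ∈ closure (ρ '' A) := by
    by_cases a0 : (0 : Fin 4) ∈ A <;> by_cases a1 : (1 : Fin 4) ∈ A <;>
      by_cases a2 : (2 : Fin 4) ∈ A <;> by_cases a3 : (3 : Fin 4) ∈ A
    · have : A = Set.univ := by
        ext x; fin_cases x <;> simpa
      rw [this, Set.image_univ, htop]
      exact mem_top g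
    · exact hmono (by simp [Set.insert_subset_iff, *]) (hA3 a3)
    · exact hmono (by simp [Set.insert_subset_iff, *]) (hA2 a2)
    · exact hmono (by simp [Set.insert_subset_iff, *]) (m23 (hA2 a2) (hA3 a3))
    · exact hmono (by simp [Set.insert_subset_iff, *]) (hA1 a1)
    · exact hmono (by simp [Set.insert_subset_iff, *]) (m13 (hA1 a1) (hA3 a3))
    · exact hmono (by simp [Set.insert_subset_iff, *]) (m12 (hA1 a1) (hA2 a2))
    · exact hmono (by simp [*]) (m123 (hA1 a1) (hA2 a2) (hA3 a3))
    · exact hmono (by simp [Set.insert_subset_iff, *]) (hA0 a0)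
    · exact hmono (by simp [Set.insert_subset_iff, *]) (hD ⟨hA0 a0, hA3 a3⟩)
    · exact hmono (by simp [Set.insert_subset_iff, *]) (m02 (hA0 a0) (hA2 a2))
    · exact hmono (by simp [*]) (m023 (hA0 a0) (hA2 a2) (hA3 a3))
    · exact hmono (by simp [Set.insert_subset_iff, *]) (m01 (hA0 a0) (hA1 a1))
    · exact hmono (by simp [*]) (m013 (hA0 a0) (hA1 a1) (hA3 a3))
    · exact hmono (by simp [*]) (m012 (hA0 a0) (hA1 a1) (hA2 a2))
    · have hg : g = 1 := by
        rcases hsingle (m123 (hA1 a1) (hA2 a2) (hA3 a3)) with h | h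
        · exact h
        · exact absurd (h ▸ hA0 a0) h0
      exact hg ▸ one_mem _
  refine le_antisymm (fun g hg => ?_) (le_inf (hmono Set.inter_subset_left)
    (hmono Set.inter_subset_right))
  have hout {i : Fin 4} {B : Set (Fin 4)} (hB : ∀ j, j ≠ i → j ∈ B) (hi : i ∉ I ∩ J) :
      g ∈ closure (ρ '' B) := by
    by_cases hiI : i ∈ I
    · refine hmono (fun j hj => hB j ?_) hg.2
      rintro rfl
      exact hi ⟨hiI, hj⟩
    · refine hmono (fun j hj => hB j ?_) hg.1
      rintro rfl
      exact hiI hj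
  exact key _ g (hout (by decide)) (hout (by decide)) (hout (by decide)) (hout (by decide))

end StringIntersection

section Odd

open Matrix
variable {F : Type*} [Field F]

/-- An alternating form preserved up to sign by the first three generators. -/
def formMatrix (l : Fˣ) : Matrix (Fin 4) (Fin 4) F :=
  !![0, l, -l, l; -l, 0, 1 - l, 1; l, l - 1, 0, 1; -l, -1, -1, 0]

theorem gen_mem_signedIsometries (l : Fˣ) {i : Fin 4} (hi : i ≠ 3) :
    gen l i ∈ signedIsometries (formMatrix l) := by
  fin_cases i
  · refine ⟨1, by simp, ?_⟩
    ext a b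
    fin_cases a <;> fin_cases b <;>
      simp [coe_gen, genMatrix, formMatrix, Matrix.mul_apply, Fin.sum_univ_four]
  · refine ⟨-1, by simp, ?_⟩
    ext a b
    fin_cases a <;> fin_cases b <;>
      simp [coe_gen, genMatrix, formMatrix, Matrix.mul_apply, Fin.sum_univ_four] <;> ring
  · refine ⟨-1, by simp, ?_⟩
    ext a b
    fin_cases a <;> fin_cases b <;>
      simp [coe_gen, genMatrix, formMatrix, Matrix.mul_apply, Fin.sum_univ_four]
  · exact absurd rfl hi

/-- Integral monomial-affine matrices normalized by `gen l 1` and `gen l 2`. -/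
def affMatrix (F : Type*) [Field F] (a b c x y z : ℤ) : Matrix (Fin 4) (Fin 4) F :=
  !![1, a, b, c; 0, x, 0, 0; 0, 0, y, 0; 0, 0, 0, z]

theorem gen_mul_affMatrix (l : Fˣ) (a b c x y z : ℤ) :
    genMatrix l 1 * affMatrix F a b c x y z =
      affMatrix F (1 - a - x) c b x z y * genMatrix l 1 ∧
    genMatrix l 2 * affMatrix F a b c x y z =
      affMatrix F b a (-c) y x z * genMatrix l 2 ∧
    genMatrix l 3 * affMatrix F a b c x y z = affMatrix F a b c x (-y) (-z) := by
  refine ⟨?_, ?_, ?_⟩ <;>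
  · ext i j
    fin_cases i <;> fin_cases j <;>
      simp [genMatrix, affMatrix, Matrix.mul_apply, Fin.sum_univ_four] <;> ring

theorem exists_affMatrix_mul {l : Fˣ} {u : Matrix.SpecialLinearGroup (Fin 4) F}
    (hu : u ∈ Subgroup.closure (gen l '' {1, 2, 3})) :
    ∃ (a b c x y z : ℤ) (d : Matrix.SpecialLinearGroup (Fin 4) F),
      d ∈ Subgroup.closure (gen l '' {1, 2}) ∧
      (u : Matrix (Fin 4) (Fin 4) F) = affMatrix F a b c x y z * d := by
  have hstep (r u : Matrix.SpecialLinearGroup (Fin 4) F) (hr : r ∈ gen l '' {1, 2, 3})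
      (h : ∃ (a b c x y z : ℤ) (d : Matrix.SpecialLinearGroup (Fin 4) F),
        d ∈ Subgroup.closure (gen l '' {1, 2}) ∧
        (u : Matrix (Fin 4) (Fin 4) F) = affMatrix F a b c x y z * d) :
      ∃ (a b c x y z : ℤ) (d : Matrix.SpecialLinearGroup (Fin 4) F),
        d ∈ Subgroup.closure (gen l '' {1, 2}) ∧
        ((r * u : Matrix.SpecialLinearGroup (Fin 4) F) : Matrix (Fin 4) (Fin 4) F) =
          affMatrix F a b c x y z * d := by
    obtain ⟨a, b, c, x, y, z, d, hd, h⟩ := h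
    obtain ⟨h1, h2, h3⟩ := gen_mul_affMatrix (F := F) l a b c x y z
    obtain ⟨i, hi, rfl⟩ := hr
    rcases hi with rfl | rfl | rfl
    · refine ⟨1 - a - x, c, b, x, z, y, gen l 1 * d,
        mul_mem (Subgroup.subset_closure ⟨1, by simp, rfl⟩) hd, ?_⟩
      rw [Matrix.SpecialLinearGroup.coe_mul, Matrix.SpecialLinearGroup.coe_mul, h, coe_gen,
        ← Matrix.mul_assoc, h1, Matrix.mul_assoc]
    · refine ⟨b, a, -c, y, x, z, gen l 2 * d,
        mul_mem (Subgroup.subset_closure ⟨2, by simp, rfl⟩) hd, ?_⟩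
      rw [Matrix.SpecialLinearGroup.coe_mul, Matrix.SpecialLinearGroup.coe_mul, h, coe_gen,
        ← Matrix.mul_assoc, h2, Matrix.mul_assoc]
    · refine ⟨a, b, c, x, -y, -z, d, hd, ?_⟩
      rw [Matrix.SpecialLinearGroup.coe_mul, h, coe_gen, ← Matrix.mul_assoc, h3]
  induction hu using Subgroup.closure_induction_left with
  | one =>
    refine ⟨0, 0, 0, 1, 1, 1, 1, one_mem _, ?_⟩
    ext i j
    fin_cases i <;> fin_cases j <;> simp [affMatrix]
  | mul_left r hr u _ hu => exact hstep r u hr hu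
  | inv_mul_cancel r hr u _ hu =>
    have : r⁻¹ = r := by
      obtain ⟨i, hi, rfl⟩ := hr
      refine inv_eq_of_mul_eq_one_right (gen_mul_self l ?_)
      rintro rfl
      simp at hi
    rw [this]
    exact hstep r u hr hu

theorem genMatrix_one_mul_two (l : Fˣ) : genMatrix l 1 * genMatrix l 2 =
    !![1, 0, 1, 0; 0, 0, -1, 0; 0, 0, 0, -1; 0, 1, 0, 0] := by
  ext i j
  fin_cases i <;> fin_cases j <;> simp [genMatrix, Matrix.mul_apply, Fin.sum_univ_four]

theorem coe_gen_one_mul_two_zpow (l : Fˣ) (m : ℤ) :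
    (((gen l 1 * gen l 2) ^ (3 * m) : Matrix.SpecialLinearGroup (Fin 4) F) :
      Matrix (Fin 4) (Fin 4) F) = affMatrix F (-m) m (-m) 1 1 1 := by
  have hadd (m n : ℤ) : affMatrix F (-m) m (-m) 1 1 1 * affMatrix F (-n) n (-n) 1 1 1 =
      affMatrix F (-(m + n)) (m + n) (-(m + n)) 1 1 1 := by
    ext i j
    fin_cases i <;> fin_cases j <;>
      simp [affMatrix, Matrix.mul_apply, Fin.sum_univ_four, add_comm]
  have h3 : (((gen l 1 * gen l 2) ^ (3 : ℤ) : Matrix.SpecialLinearGroup (Fin 4) F) :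
      Matrix (Fin 4) (Fin 4) F) = affMatrix F (-1) 1 (-1) 1 1 1 := by
    rw [show (3 : ℤ) = ((3 : ℕ) : ℤ) from rfl, zpow_natCast, pow_succ, pow_two]
    simp only [Matrix.SpecialLinearGroup.coe_mul, coe_gen, genMatrix_one_mul_two]
    ext i j
    fin_cases i <;> fin_cases j <;> simp [affMatrix, Matrix.mul_apply, Fin.sum_univ_four]
  have h0 : affMatrix F (-0) 0 (-0) 1 1 1 = 1 := by
    ext i j
    fin_cases i <;> fin_cases j <;> simp [affMatrix]
  rw [_root_.zpow_mul]
  induction m using Int.induction_on with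
  | zero => rw [zpow_zero, Matrix.SpecialLinearGroup.coe_one, h0]
  | succ m ih => rw [_root_.zpow_add_one, Matrix.SpecialLinearGroup.coe_mul, ih, h3, hadd]
  | pred m ih =>
    have h3' : affMatrix F (-1) 1 (-1) 1 1 1 * affMatrix F (- -1) (-1) (- -1) 1 1 1 = 1 := by
      rw [hadd, ← h0]; rfl
    have hinv : ((((gen l 1 * gen l 2) ^ (3 : ℤ))⁻¹ : Matrix.SpecialLinearGroup (Fin 4) F) :
        Matrix (Fin 4) (Fin 4) F) = affMatrix F (- -1) (-1) (- -1) 1 1 1 := by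
      have h := congrArg (fun A => ((((gen l 1 * gen l 2) ^ (3 : ℤ))⁻¹ :
        Matrix.SpecialLinearGroup (Fin 4) F) : Matrix (Fin 4) (Fin 4) F) * A) h3'
      simp only [← h3] at h
      rw [← Matrix.mul_assoc, ← Matrix.SpecialLinearGroup.coe_mul, inv_mul_cancel,
        Matrix.SpecialLinearGroup.coe_one, Matrix.one_mul, Matrix.mul_one] at h
      exact h.symm
    rw [_root_.zpow_sub_one, Matrix.SpecialLinearGroup.coe_mul, ih, hinv, hadd, ← sub_eq_add_neg]

theorem eq_one_or_eq_gen_two {l : Fˣ} {u : Matrix.SpecialLinearGroup (Fin 4) F}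
    (hu : u ∈ Subgroup.closure (gen l '' {1, 2}))
    (h3 : u ∈ lineStabilizer (Pi.single 3 1 : Fin 4 → F)) : u = 1 ∨ u = gen l 2 := by
  have hpow (k : ℤ) (hk : (gen l 1 * gen l 2) ^ k ∈ lineStabilizer (Pi.single 3 1 : Fin 4 → F)) :
      (gen l 1 * gen l 2) ^ k = 1 := by
    obtain ⟨c, hc⟩ := hk
    rw [mulVec_single_one] at hc
    have hk : k = k % 3 + 3 * (k / 3) := (Int.emod_add_mul_ediv k 3).symm
    have hs : (((gen l 1 * gen l 2) ^ k : Matrix.SpecialLinearGroup (Fin 4) F) :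
        Matrix (Fin 4) (Fin 4) F) = (genMatrix l 1 * genMatrix l 2) ^ (k % 3).toNat *
          affMatrix F (-(k / 3)) (k / 3) (-(k / 3)) 1 1 1 := by
      conv_lhs => rw [hk]
      rw [_root_.zpow_add, Matrix.SpecialLinearGroup.coe_mul, coe_gen_one_mul_two_zpow]
      congr 1
      rw [← Int.toNat_of_nonneg (Int.emod_nonneg k (by norm_num : (3 : ℤ) ≠ 0)), zpow_natCast,
        Matrix.SpecialLinearGroup.coe_pow, Matrix.SpecialLinearGroup.coe_mul, coe_gen, coe_gen,
        Int.toNat_natCast]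
    rw [hs, genMatrix_one_mul_two] at hc
    have h0 := congrFun hc 0
    have h1 := congrFun hc 1
    have h2 := congrFun hc 2
    have hlt := Int.emod_lt_of_pos k (by norm_num : (0 : ℤ) < 3)
    have hnn := Int.emod_nonneg k (by norm_num : (3 : ℤ) ≠ 0)
    generalize k % 3 = r at *
    interval_cases r
    · simp [affMatrix] at h0
      apply Subtype.ext
      rw [hs]
      ext i j
      fin_cases i <;> fin_cases j <;> simp [affMatrix, h0]
    · simp [affMatrix] at h2
    · simp [affMatrix, pow_two] at h1
  have hg2 : gen l 2 ∈ lineStabilizer (Pi.single 3 1 : Fin 4 → F) := by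
    refine ⟨-1, ?_⟩
    rw [mulVec_single_one]
    ext i
    fin_cases i <;> simp [coe_gen, genMatrix]
  rw [Set.image_pair] at hu
  obtain ⟨k, rfl | rfl⟩ :=
    exists_zpow_of_mem_closure_pair (gen_mul_self l (by decide)) (gen_mul_self l (by decide)) hu
  · exact Or.inl (hpow k h3)
  · have := mul_mem h3 (inv_mem hg2)
    rw [mul_inv_cancel_right] at this
    rw [hpow k this, one_mul]
    exact Or.inr rfl

end Odd

section OddConclusion

open Matrix
variable {F : Type*} [Field F]

theorem eq_affMatrix_of_mem_signedIsometries {l : Fˣ} {n : Matrix.SpecialLinearGroup (Fin 4) F}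
    (hn : n ∈ signedIsometries (formMatrix l)) {a b c x y z : ℤ}
    (h : (n : Matrix (Fin 4) (Fin 4) F) = affMatrix F a b c x y z) :
    (n : Matrix (Fin 4) (Fin 4) F) = affMatrix F a (-a) a 1 1 1 := by
  obtain ⟨s, hs, hn⟩ := hn
  have hl : (l : F) ≠ 0 := l.ne_zero
  have hdet : (x : F) * y * z = 1 := by
    have := n.2
    rw [h] at this
    simpa [affMatrix, Matrix.det_succ_row_zero, Fin.sum_univ_succ, mul_assoc] using this
  rw [h] at hn
  have h01 := congrFun (congrFun hn 0) 1
  have h02 := congrFun (congrFun hn 0) 2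
  have h03 := congrFun (congrFun hn 0) 3
  have h12 := congrFun (congrFun hn 1) 2
  have h13 := congrFun (congrFun hn 1) 3
  simp [affMatrix, formMatrix, Matrix.mul_apply, Fin.sum_univ_four] at h01 h02 h03 h12 h13
  have hxs : (x : F) = s := mul_left_cancel₀ hl (by linear_combination h01)
  have hys : (y : F) = s := mul_left_cancel₀ hl (by linear_combination h02)
  have hzs : (z : F) = s := mul_left_cancel₀ hl (by linear_combination h03)
  have hs1 : s = 1 := by
    rw [hxs, hys, hzs, hs, one_mul] at hdet
    exact hdet
  rw [hs1] at hxs hys hzs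
  rw [hxs, hys, hs1] at h12
  rw [hxs, hzs, hs1] at h13
  have hb : (b : F) = -a := mul_left_cancel₀ hl (by linear_combination -h12)
  have hc : (c : F) = a := mul_left_cancel₀ hl (by linear_combination -h13)
  rw [h]
  simp [affMatrix, hxs, hys, hzs, hb, hc]

theorem closure_pgen_inf_le (l : Fˣ) :
    Subgroup.closure (pgen l '' {1, 2, 3}) ⊓ Subgroup.closure (pgen l '' {0, 1, 2}) ≤
      Subgroup.closure (pgen l '' {1, 2}) := by
  intro x hx
  obtain ⟨h1, h2⟩ := Subgroup.mem_inf.1 hx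
  obtain ⟨u, hu, rfl⟩ := exists_mem_closure_of_mk_mem_closure (r := gen l) h1
  have hus : u ∈ signedIsometries (formMatrix l) := by
    refine mem_of_mk_mem_closure (r := gen l) (center_le_signedIsometries _) ?_ h2
    rintro i (rfl | rfl | rfl) <;> exact gen_mem_signedIsometries l (by decide)
  obtain ⟨a, b, c, x, y, z, d, hd, h⟩ := exists_affMatrix_mul hu
  have hds : d ∈ signedIsometries (formMatrix l) := by
    refine (Subgroup.closure_le _).2 ?_ hd
    rintro _ ⟨i, rfl | rfl, rfl⟩ <;> exact gen_mem_signedIsometries l (by decide)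
  have hn : ((u * d⁻¹ : Matrix.SpecialLinearGroup (Fin 4) F) : Matrix (Fin 4) (Fin 4) F) =
      affMatrix F a b c x y z := by
    rw [Matrix.SpecialLinearGroup.coe_mul, h, Matrix.mul_assoc,
      ← Matrix.SpecialLinearGroup.coe_mul, mul_inv_cancel, Matrix.SpecialLinearGroup.coe_one,
      Matrix.mul_one]
  have hn' := eq_affMatrix_of_mem_signedIsometries (mul_mem hus (inv_mem hds)) hn
  have hn'' : u * d⁻¹ = (gen l 1 * gen l 2) ^ (3 * -a) := by
    apply Subtype.ext
    rw [hn', coe_gen_one_mul_two_zpow, neg_neg]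
  refine mk_mem_closure (r := gen l) ?_
  rw [← inv_mul_cancel_right u d, hn'']
  refine mul_mem (zpow_mem (mul_mem (Subgroup.subset_closure ?_) (Subgroup.subset_closure ?_)) _) hd
  · exact ⟨1, by simp, rfl⟩
  · exact ⟨2, by simp, rfl⟩

theorem gen_mem_lineStabilizer_zero (l : Fˣ) {i : Fin 4} (hi : i ≠ 0) :
    gen l i ∈ lineStabilizer (Pi.single 0 1 : Fin 4 → F) := by
  refine ⟨1, ?_⟩
  rw [mulVec_single_one, coe_gen]
  fin_cases i
  · exact absurd rfl hi
  all_goals ext j; fin_cases j <;> simp [genMatrix]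

theorem gen_mem_lineStabilizer_three (l : Fˣ) {i : Fin 4} (hi : i = 2 ∨ i = 3) :
    gen l i ∈ lineStabilizer (Pi.single 3 1 : Fin 4 → F) := by
  refine ⟨-1, ?_⟩
  rw [mulVec_single_one, coe_gen]
  rcases hi with rfl | rfl <;> ext j <;> fin_cases j <;> simp [genMatrix]

theorem gen_zero_not_mem_lineStabilizer (l : Fˣ) :
    gen l 0 ∉ lineStabilizer (Pi.single 0 1 : Fin 4 → F) := by
  rintro ⟨c, hc⟩
  rw [mulVec_single_one, coe_gen] at hc
  simpa [genMatrix] using congrFun hc 3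

theorem pgen_zero_not_mem (l : Fˣ) : pgen l 0 ∉ Subgroup.closure (pgen l '' {1, 2, 3}) := by
  intro h
  refine gen_zero_not_mem_lineStabilizer l
    (mem_of_mk_mem_closure (r := gen l) (center_le_lineStabilizer _) ?_ h)
  rintro i (rfl | rfl | rfl) <;> exact gen_mem_lineStabilizer_zero l (by decide)

theorem closure_pgen_two_three_inf_le (l : Fˣ) :
    Subgroup.closure (pgen l '' {2, 3}) ⊓ Subgroup.closure (pgen l '' {1, 2}) ≤
      Subgroup.closure (pgen l '' {2}) := by
  intro x hx
  obtain ⟨h1, h2⟩ := Subgroup.mem_inf.1 hx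
  obtain ⟨u, hu, rfl⟩ := exists_mem_closure_of_mk_mem_closure (r := gen l) h2
  have hus : u ∈ lineStabilizer (Pi.single 3 1 : Fin 4 → F) :=
    mem_of_mk_mem_closure (r := gen l) (center_le_lineStabilizer _)
      (fun i hi => gen_mem_lineStabilizer_three l hi) h1
  obtain rfl | rfl := eq_one_or_eq_gen_two hu hus
  · exact one_mem _
  · exact Subgroup.subset_closure ⟨2, rfl, rfl⟩

/-- Conjugation by `gen l 0` swaps the stabilizers of the first and the last coordinate lines. -/
theorem mem_lineStabilizer_three_of_conj {l : Fˣ} {u : Matrix.SpecialLinearGroup (Fin 4) F}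
    (hu : gen l 0 * u * (gen l 0)⁻¹ ∈ lineStabilizer (Pi.single 0 1 : Fin 4 → F)) :
    u ∈ lineStabilizer (Pi.single 3 1 : Fin 4 → F) := by
  obtain ⟨c, hc⟩ := hu
  have h3 : (gen l 0 : Matrix (Fin 4) (Fin 4) F) *ᵥ Pi.single 3 1 =
      -(l : F)⁻¹ • (Pi.single 0 1 : Fin 4 → F) := by
    rw [mulVec_single_one, coe_gen]
    ext j
    fin_cases j <;> simp [genMatrix]
  have h0 : (gen l 0 : Matrix (Fin 4) (Fin 4) F) *ᵥ Pi.single 0 1 =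
      (l : F) • (Pi.single 3 1 : Fin 4 → F) := by
    rw [mulVec_single_one, coe_gen]
    ext j
    fin_cases j <;> simp [genMatrix]
  have hl : (l : F) ≠ 0 := l.ne_zero
  have hi : ((gen l 0)⁻¹ : Matrix.SpecialLinearGroup (Fin 4) F).1 *ᵥ (Pi.single 0 1 : Fin 4 → F)
      = -(l : F) • Pi.single 3 1 := by
    have h := congrArg (((gen l 0)⁻¹ : Matrix.SpecialLinearGroup (Fin 4) F).1 *ᵥ ·) h3
    simp only [mulVec_mulVec, mulVec_smul] at h
    rw [← Matrix.SpecialLinearGroup.coe_mul, inv_mul_cancel, Matrix.SpecialLinearGroup.coe_one,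
      one_mulVec] at h
    rw [h, smul_smul, neg_mul_neg, mul_inv_cancel₀ hl, one_smul]
  refine ⟨c, ?_⟩
  rw [Matrix.SpecialLinearGroup.coe_mul, Matrix.SpecialLinearGroup.coe_mul, ← mulVec_mulVec, hi,
    mulVec_smul, ← mulVec_mulVec] at hc
  have h := congrArg (((gen l 0)⁻¹ : Matrix.SpecialLinearGroup (Fin 4) F).1 *ᵥ ·) hc
  simp only [mulVec_smul] at h
  rw [mulVec_mulVec, ← Matrix.SpecialLinearGroup.coe_mul, inv_mul_cancel,
    Matrix.SpecialLinearGroup.coe_one, one_mulVec, hi, smul_comm c] at h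
  exact smul_right_injective _ (neg_ne_zero.2 hl) h

theorem pgen_one_mul_two_mul_self_ne_one (l : Fˣ) : pgen l 1 * pgen l 2 * pgen l 1 ≠ pgen l 2 := by
  intro h
  obtain ⟨c, hc⟩ := coe_eq_smul_of_mk_eq_mk (g := gen l 1 * gen l 2 * gen l 1) (h := gen l 2) h
  have h0 := congrFun (congrFun hc 3) 3
  have h1 := congrFun (congrFun hc 1) 2
  simp [coe_gen, genMatrix] at h0 h1

theorem closure_pgen_zero_one_inf_le (l : Fˣ) :
    Subgroup.closure (pgen l '' {0, 1}) ⊓ Subgroup.closure (pgen l '' {1, 2}) ≤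
      Subgroup.closure (pgen l '' {1}) := by
  intro x hx
  obtain ⟨h1, h2⟩ := Subgroup.mem_inf.1 hx
  have hρ1 : pgen l 1 ∈ Subgroup.closure (pgen l '' {1, 2}) :=
    Subgroup.subset_closure ⟨1, by simp, rfl⟩
  have key (k : ℤ) (hk : (pgen l 0 * pgen l 1) ^ k ∈ Subgroup.closure (pgen l '' {1, 2})) :
      (pgen l 0 * pgen l 1) ^ k = 1 := by
    have hinv (i : Fin 4) (hi : pgen l i * (pgen l 0 * pgen l 1) * (pgen l i)⁻¹ =
        (pgen l 0 * pgen l 1)⁻¹) :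
        pgen l i * (pgen l 0 * pgen l 1) ^ k * (pgen l i)⁻¹ = ((pgen l 0 * pgen l 1) ^ k)⁻¹ := by
      rw [← conj_zpow, hi, _root_.inv_zpow]
    have h0 := hinv 0 (by
      simp only [_root_.mul_inv_rev, inv_eq_of_mul_eq_one_right (pgen_mul_self l _), ← mul_assoc,
        pgen_mul_self, one_mul])
    have h1 := hinv 1 (by
      simp only [_root_.mul_inv_rev, inv_eq_of_mul_eq_one_right (pgen_mul_self l _), mul_assoc,
        pgen_mul_self, mul_one])
    generalize (pgen l 0 * pgen l 1) ^ k = y at hk h0 h1 ⊢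
    obtain ⟨u, hu, rfl⟩ := exists_mem_closure_of_mk_mem_closure (r := gen l) hk
    have hu0 : u ∈ lineStabilizer (Pi.single 0 1 : Fin 4 → F) := by
      refine (Subgroup.closure_le _).2 ?_ hu
      rintro _ ⟨i, rfl | rfl, rfl⟩ <;> exact gen_mem_lineStabilizer_zero l (by decide)
    have hu3 : u ∈ lineStabilizer (Pi.single 3 1 : Fin 4 → F) := by
      refine mem_lineStabilizer_three_of_conj (l := l) ?_
      obtain ⟨c, hc⟩ := coe_eq_smul_of_mk_eq_mk (g := u⁻¹) (h := gen l 0 * u * (gen l 0)⁻¹) h0.symm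
      obtain ⟨d, hd⟩ := inv_mem hu0
      exact ⟨c * d, by rw [hc, smul_mulVec, hd, smul_smul]⟩
    obtain rfl | rfl := eq_one_or_eq_gen_two hu hu3
    · rfl
    · refine absurd ?_ (pgen_one_mul_two_mul_self_ne_one l)
      rw [inv_eq_of_mul_eq_one_right (pgen_mul_self l 1)] at h1
      exact h1.trans (inv_eq_of_mul_eq_one_right (pgen_mul_self l 2))
  rw [Set.image_pair] at h1
  obtain ⟨k, rfl | rfl⟩ :=
    exists_zpow_of_mem_closure_pair (pgen_mul_self l 0) (pgen_mul_self l 1) h1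
  · rw [key k h2]
    exact one_mem _
  · have := mul_mem h2 (inv_mem hρ1)
    rw [mul_inv_cancel_right] at this
    rw [key k this, one_mul]
    exact Subgroup.subset_closure ⟨1, rfl, rfl⟩

theorem pgen_one_ne_two (l : Fˣ) : pgen l 1 ≠ pgen l 2 := by
  intro h
  obtain ⟨c, hc⟩ := coe_eq_smul_of_mk_eq_mk (g := gen l 1) (h := gen l 2) h
  simpa [coe_gen, genMatrix] using congrFun (congrFun hc 3) 3

theorem pgen_two_ne_three (l : Fˣ) : pgen l 2 ≠ pgen l 3 := by
  intro h
  obtain ⟨c, hc⟩ := coe_eq_smul_of_mk_eq_mk (g := gen l 2) (h := gen l 3) h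
  simpa [coe_gen, genMatrix] using congrFun (congrFun hc 1) 1

theorem exists_isStringCGroupRep_of_odd [Fintype F] (hF : Odd (Fintype.card F)) :
    ∃ ρ : Fin 4 → Matrix.ProjectiveSpecialLinearGroup (Fin 4) F,
      (∀ i, orderOf (ρ i) = 2) ∧ Subgroup.closure (Set.range ρ) = ⊤ ∧
      (∀ i j : Fin 4, i.val + 1 < j.val → Commute (ρ i) (ρ j)) ∧
      (∀ I J : Set (Fin 4),
        Subgroup.closure (ρ '' I) ⊓ Subgroup.closure (ρ '' J) =
          Subgroup.closure (ρ '' (I ∩ J))) := by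
  obtain ⟨l, hl⟩ := IsCyclic.exists_generator (α := Fˣ)
  have : NeZero (2 : F) := ⟨fun h => by
    rw [← Nat.not_even_iff_odd, Nat.even_iff, ← FiniteField.even_card_iff_char_two] at hF
    exact hF (CharP.ringChar_of_prime_eq_zero Nat.prime_two (by exact_mod_cast h))⟩
  have htop := closure_pgen_eq_top hF hl
  exact ⟨pgen l, orderOf_pgen l, htop, pgen_commute l,
    intersection_property_of_rank_four (pgen_mul_self l) (pgen_ne_one l) (pgen_commute l) htop
      (pgen_one_ne_two l) (pgen_two_ne_three l) (pgen_zero_not_mem l) (closure_pgen_inf_le l)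
      (closure_pgen_zero_one_inf_le l) (closure_pgen_two_three_inf_le l)⟩

end OddConclusion

section Lines

variable {F V : Type*} [Field F] [AddCommGroup V] [Module F V] [FiniteDimensional F V]
open Module

theorem finrank_span_singleton_sup_le (S : Submodule F V) (x : V) :
    finrank F ↥(F ∙ x ⊔ S) ≤ finrank F S + 1 := by
  have h1 := Submodule.finrank_add_le_finrank_add_finrank (F ∙ x) S
  have h2 := finrank_span_le_card (R := F) ({x} : Set V)
  simp at h2
  omega

theorem one_le_finrank_of_mem {S : Submodule F V} {x : V} (hx : x ∈ S) (h0 : x ≠ 0) :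
    1 ≤ finrank F S :=
  (Submodule.one_le_finrank_iff).2 fun h => h0 (by simpa [h] using hx)

theorem exists_ne_zero_of_finrank_sup {L M : Submodule F V} (hL : finrank F L = 2)
    (hM : finrank F M = 2) (h : finrank F ↥(L ⊔ M) ≤ 3) : ∃ x ∈ L, x ∈ M ∧ x ≠ 0 := by
  have h' := Submodule.finrank_sup_add_finrank_inf_eq L M
  have h1 : 1 ≤ finrank F ↥(L ⊓ M) := by omega
  obtain ⟨x, hx, h0⟩ := Submodule.exists_mem_ne_zero_of_ne_bot (Submodule.one_le_finrank_iff.1 h1)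
  exact ⟨x, hx.1, hx.2, h0⟩

theorem finrank_sup_le_of_mem {S L : Submodule F V} (hL : finrank F L = 2) {x : V} (hxS : x ∈ S)
    (hxL : x ∈ L) (h0 : x ≠ 0) : finrank F ↥(S ⊔ L) ≤ finrank F S + 1 := by
  have h := Submodule.finrank_sup_add_finrank_inf_eq S L
  have h1 := one_le_finrank_of_mem (S := S ⊓ L) ⟨hxS, hxL⟩ h0
  omega

/-- A plane not contained in `S` meets `S` in at most a line. -/
theorem mem_span_singleton_of_mem_inf {S L : Submodule F V} (hL : finrank F L = 2) (hLS : ¬ L ≤ S)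
    {x y : V} (hxL : x ∈ L) (hxS : x ∈ S) (hyL : y ∈ L) (hyS : y ∈ S) (hy : y ≠ 0) :
    x ∈ F ∙ y := by
  have hlt : finrank F ↥(L ⊓ S) < finrank F L :=
    Submodule.finrank_lt_finrank_of_lt (inf_le_left.lt_of_ne fun h => hLS (inf_eq_left.1 h))
  have hle : F ∙ y ≤ L ⊓ S := (Submodule.span_singleton_le_iff_mem _ _).2 ⟨hyL, hyS⟩
  rw [Submodule.eq_of_le_of_finrank_le hle (by rw [finrank_span_singleton hy]; omega)]
  exact ⟨hxL, hxS⟩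

/-- A plane meeting `S` nontrivially is spanned modulo `S` by any of its vectors outside `S`. -/
theorem le_span_singleton_sup {S L : Submodule F V} (hL : finrank F L = 2)
    {x y : V} (hxL : x ∈ L) (hxS : x ∉ S) (hyL : y ∈ L) (hyS : y ∈ S) (hy : y ≠ 0) :
    L ≤ F ∙ x ⊔ S := by
  have hle : F ∙ x ⊔ L ⊓ S ≤ L := sup_le ((Submodule.span_singleton_le_iff_mem _ _).2 hxL) inf_le_left
  have hlt : finrank F ↥(L ⊓ S) < finrank F ↥(F ∙ x ⊔ L ⊓ S) := by
    refine Submodule.finrank_lt_finrank_of_lt (le_sup_right.lt_of_ne fun h => hxS ?_)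
    have : x ∈ L ⊓ S := by
      rw [h]
      exact Submodule.mem_sup_left (Submodule.mem_span_singleton_self x)
    exact this.2
  have h1 := one_le_finrank_of_mem (S := L ⊓ S) ⟨hyL, hyS⟩ hy
  rw [← Submodule.eq_of_le_of_finrank_le hle (by omega)]
  exact sup_le_sup le_rfl inf_le_right

theorem finrank_sup_four_planes {L₀ L₁ L₂ L₃ : Submodule F V}
    (h0 : finrank F L₀ = 2) (h3 : finrank F L₃ = 2) (h02 : finrank F ↥(L₀ ⊔ L₂) ≤ 3)
    (h13 : finrank F ↥(L₁ ⊔ L₃) ≤ 3) (h03 : finrank F ↥(L₀ ⊔ L₃) ≤ 3) :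
    finrank F ↥((L₀ ⊔ L₂) ⊔ (L₁ ⊔ L₃)) < 6 := by
  obtain ⟨x, hx0, hx3, hx⟩ := exists_ne_zero_of_finrank_sup h0 h3 h03
  have h := Submodule.finrank_sup_add_finrank_inf_eq (L₀ ⊔ L₂) (L₁ ⊔ L₃)
  have := one_le_finrank_of_mem (S := (L₀ ⊔ L₂) ⊓ (L₁ ⊔ L₃))
    ⟨Submodule.mem_sup_left hx0, Submodule.mem_sup_right hx3⟩ hx
  omega

theorem exists_common_vector_of_five_planes {L₀ L₁ L₂ L₃ L₄ : Submodule F V}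
    (h0 : finrank F L₀ = 2) (h1 : finrank F L₁ = 2) (h2 : finrank F L₂ = 2)
    (h3 : finrank F L₃ = 2) (h4 : finrank F L₄ = 2) (h02 : finrank F ↥(L₀ ⊔ L₂) ≤ 3)
    (h03 : finrank F ↥(L₀ ⊔ L₃) ≤ 3) (h04 : finrank F ↥(L₀ ⊔ L₄) ≤ 3)
    (h13 : finrank F ↥(L₁ ⊔ L₃) ≤ 3) (h14 : finrank F ↥(L₁ ⊔ L₄) ≤ 3)
    (h24 : finrank F ↥(L₂ ⊔ L₄) ≤ 3)
    (h : 6 ≤ finrank F ↥(L₀ ⊔ L₄ ⊔ L₁ ⊔ L₃ ⊔ L₂)) :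
    ∃ x ≠ 0, x ∈ L₀ ∧ x ∈ L₁ ∧ x ∈ L₂ ∧ x ∈ L₃ ∧ x ∈ L₄ := by
  obtain ⟨x, hx1, hx3, hx⟩ := exists_ne_zero_of_finrank_sup h1 h3 h13
  obtain ⟨a, ha1, ha4, ha⟩ := exists_ne_zero_of_finrank_sup h1 h4 h14
  obtain ⟨b, hb0, hb3, hb⟩ := exists_ne_zero_of_finrank_sup h0 h3 h03
  obtain ⟨c, hc0, hc2, hc⟩ := exists_ne_zero_of_finrank_sup h0 h2 h02
  obtain ⟨d, hd2, hd4, hd⟩ := exists_ne_zero_of_finrank_sup h2 h4 h24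
  have ha' : a ∈ L₀ ⊔ L₄ := Submodule.mem_sup_right ha4
  have hb' : b ∈ L₀ ⊔ L₄ := Submodule.mem_sup_left hb0
  have hc' : c ∈ L₀ ⊔ L₄ := Submodule.mem_sup_left hc0
  have hd' : d ∈ L₀ ⊔ L₄ := Submodule.mem_sup_right hd4
  have hA1 := finrank_sup_le_of_mem h1 ha' ha1 ha
  have hA3 (S : Submodule F V) (hS : L₀ ⊔ L₄ ≤ S) := finrank_sup_le_of_mem h3 (hS hb') hb3 hb
  have hA2 (S : Submodule F V) (hS : L₀ ⊔ L₄ ≤ S) := finrank_sup_le_of_mem h2 (hS hc') hc2 hc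
  have i1 := hA3 (L₀ ⊔ L₄ ⊔ L₁) le_sup_left
  have i2 := hA2 (L₀ ⊔ L₄ ⊔ L₁ ⊔ L₃) (le_sup_left.trans le_sup_left)
  have hxA : x ∈ L₀ ⊔ L₄ := by
    by_contra hxA
    have j1 := le_span_singleton_sup h1 hx1 hxA ha1 ha' ha
    have j3 := le_span_singleton_sup h3 hx3 hxA hb3 hb' hb
    have := Submodule.finrank_mono (sup_le (sup_le (le_sup_right (a := F ∙ x)) j1) j3)
    have := finrank_span_singleton_sup_le (L₀ ⊔ L₄) x
    omega
  have n1 : ¬ L₁ ≤ L₀ ⊔ L₄ := fun hle => by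
    rw [sup_eq_left.2 hle] at i1 i2 h
    omega
  have n3 : ¬ L₃ ≤ L₀ ⊔ L₄ := fun hle => by
    rw [sup_eq_left.2 (hle.trans le_sup_left)] at i2 h
    omega
  have n2 : ¬ L₂ ≤ L₀ ⊔ L₄ := fun hle => by
    rw [sup_eq_left.2 (hle.trans (le_sup_left.trans le_sup_left))] at h
    omega
  have n0 : ¬ L₀ ≤ L₄ := fun hle => by
    rw [sup_eq_right.2 hle] at *
    omega
  have hx4 : x ∈ L₄ := (Submodule.span_singleton_le_iff_mem _ _).2 ha4
    (mem_span_singleton_of_mem_inf h1 n1 hx1 hxA ha1 ha' ha)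
  have hx0 : x ∈ L₀ := (Submodule.span_singleton_le_iff_mem _ _).2 hb0
    (mem_span_singleton_of_mem_inf h3 n3 hx3 hxA hb3 hb' hb)
  have hc4 : c ∈ L₄ := (Submodule.span_singleton_le_iff_mem _ _).2 hd4
    (mem_span_singleton_of_mem_inf h2 n2 hc2 hc' hd2 hd' hd)
  have hx2 : x ∈ L₂ := (Submodule.span_singleton_le_iff_mem _ _).2 hc2
    (mem_span_singleton_of_mem_inf h0 n0 hx0 hx4 hc0 hc4 hc)
  exact ⟨x, hx, hx0, hx1, hx2, hx3, hx4⟩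

theorem exists_finset_sup_eq_top {ι : Type*} [DecidableEq ι] (L : ι → Submodule F V)
    (hL : ∀ i, finrank F (L i) = 2) (htop : ⨆ i, L i = ⊤) (hV : finrank F V = 6) :
    ∃ s : Finset ι, s.card ≤ 5 ∧ s.sup L = ⊤ := by
  have step (s : Finset ι) (hs : s.sup L ≠ ⊤) : ∃ i, ¬ L i ≤ s.sup L := by
    by_contra! hle
    exact hs (top_le_iff.1 (htop ▸ iSup_le hle))
  have key (k : ℕ) : ∃ s : Finset ι, s.card ≤ k + 1 ∧
      (s.sup L = ⊤ ∨ k + 2 ≤ finrank F ↥(s.sup L)) := by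
    induction k with
    | zero =>
      obtain ⟨i, -⟩ := step ∅ (fun h => by
        have := finrank_top F V
        rw [← h, Finset.sup_empty, finrank_bot] at this
        omega)
      exact ⟨{i}, by simp, Or.inr (by rw [Finset.sup_singleton, hL])⟩
    | succ k ih =>
      obtain ⟨s, hs, h⟩ := ih
      by_cases hst : s.sup L = ⊤
      · exact ⟨s, by omega, Or.inl hst⟩
      obtain ⟨i, hi⟩ := step s hst
      refine ⟨insert i s, (Finset.card_insert_le _ _).trans (by omega), Or.inr ?_⟩
      have := h.resolve_left hst
      have := Submodule.finrank_lt_finrank_of_lt (s := s.sup L) (t := L i ⊔ s.sup L)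
        (le_sup_right.lt_of_ne fun h => hi (h ▸ le_sup_left))
      rw [Finset.sup_insert]
      omega
  obtain ⟨s, hs, h | h⟩ := key 4
  · exact ⟨s, hs, h⟩
  · exact ⟨s, hs, Submodule.eq_top_of_finrank_eq
      (le_antisymm (Submodule.finrank_le _) (by omega))⟩

theorem finrank_sup_finset_sup_le {ι : Type*} {L : ι → Submodule F V}
    (hL : ∀ i, finrank F (L i) = 2) {S : Submodule F V} {x : V} (hxS : x ∈ S) (h0 : x ≠ 0)
    (s : Finset ι) (hs : ∀ i ∈ s, x ∈ L i) :
    finrank F ↥(S ⊔ s.sup L) ≤ finrank F S + s.card := by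
  classical
  induction s using Finset.induction_on with
  | empty => rw [Finset.sup_empty, sup_bot_eq, Finset.card_empty, add_zero]
  | insert i s hi ih =>
    have h1 := ih fun j hj => hs j (Finset.mem_insert_of_mem hj)
    have h2 := finrank_sup_le_of_mem (hL i) (Submodule.mem_sup_left (T := s.sup L) hxS)
      (hs i (Finset.mem_insert_self _ _)) h0
    rw [Finset.sup_insert, Finset.card_insert_of_notMem hi, sup_comm (L i), ← sup_assoc]
    omega

theorem exists_common_vector_of_few_planes {m : ℕ} (hm : m ≤ 5) (L : Fin m → Submodule F V)
    (hL : ∀ i, finrank F (L i) = 2)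
    (hLL : ∀ i j : Fin m, i.val + 1 < j.val → finrank F ↥(L i ⊔ L j) ≤ 3)
    (h : 6 ≤ finrank F ↥(⨆ i, L i)) : ∃ x ≠ 0, ∀ i, x ∈ L i := by
  have hadd (S T : Submodule F V) := Submodule.finrank_add_le_finrank_add_finrank S T
  interval_cases m
  · rw [iSup_of_empty, finrank_bot] at h
    omega
  · rw [iSup_unique, hL] at h
    omega
  · have : ⨆ i, L i ≤ L 0 ⊔ L 1 := iSup_le fun i => by
      fin_cases i
      exacts [le_sup_left, le_sup_right]
    have := Submodule.finrank_mono this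
    have := hadd (L 0) (L 1)
    have := hL 0
    have := hL 1
    omega
  · have : ⨆ i, L i ≤ (L 0 ⊔ L 2) ⊔ L 1 := iSup_le fun i => by
      fin_cases i
      exacts [le_sup_left.trans le_sup_left, le_sup_right, le_sup_right.trans le_sup_left]
    have := Submodule.finrank_mono this
    have := hadd (L 0 ⊔ L 2) (L 1)
    have := hLL 0 2 (by decide)
    have := hL 1
    omega
  · have : ⨆ i, L i ≤ (L 0 ⊔ L 2) ⊔ (L 1 ⊔ L 3) := iSup_le fun i => by
      fin_cases i
      exacts [le_sup_left.trans le_sup_left, le_sup_left.trans le_sup_right,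
        le_sup_right.trans le_sup_left, le_sup_right.trans le_sup_right]
    have := Submodule.finrank_mono this
    have := finrank_sup_four_planes (hL 0) (hL 3) (hLL 0 2 (by decide)) (hLL 1 3 (by decide))
      (hLL 0 3 (by decide))
    omega
  · have : ⨆ i, L i ≤ L 0 ⊔ L 4 ⊔ L 1 ⊔ L 3 ⊔ L 2 := iSup_le fun i => by
      fin_cases i
      exacts [le_sup_left.trans (le_sup_left.trans (le_sup_left.trans le_sup_left)),
        le_sup_right.trans (le_sup_left.trans le_sup_left), le_sup_right,
        le_sup_right.trans le_sup_left,
        le_sup_right.trans (le_sup_left.trans (le_sup_left.trans le_sup_left))]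
    obtain ⟨x, hx, h0, h1, h2, h3, h4⟩ := exists_common_vector_of_five_planes (hL 0) (hL 1) (hL 2)
      (hL 3) (hL 4) (hLL 0 2 (by decide)) (hLL 0 3 (by decide)) (hLL 0 4 (by decide))
      (hLL 1 3 (by decide)) (hLL 1 4 (by decide)) (hLL 2 4 (by decide))
      (h.trans (Submodule.finrank_mono this))
    refine ⟨x, hx, fun i => ?_⟩
    fin_cases i <;> assumption

/-- Planes `L i` spanning a `6`-dimensional space, such that nonconsecutive ones meet, have
a nonzero common vector. -/
theorem exists_common_vector_of_planes {n : ℕ} (hV : finrank F V = 6) (L : Fin n → Submodule F V)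
    (hL : ∀ i, finrank F (L i) = 2)
    (hLL : ∀ i j : Fin n, i.val + 1 < j.val → finrank F ↥(L i ⊔ L j) ≤ 3)
    (htop : ⨆ i, L i = ⊤) : ∃ x ≠ 0, ∀ i, x ∈ L i := by
  obtain ⟨s, hs, hsup⟩ := exists_finset_sup_eq_top L hL htop hV
  obtain ⟨x, hx0, hx⟩ := exists_common_vector_of_few_planes hs (fun i => L (s.orderEmbOfFin rfl i))
    (fun i => hL _) (fun i j hij => hLL _ _ (by
      have h1 : s.orderEmbOfFin rfl i < s.orderEmbOfFin rfl ⟨i + 1, by omega⟩ :=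
        (s.orderEmbOfFin rfl).strictMono (Fin.lt_def.2 (Nat.lt_succ_self _))
      have h2 : s.orderEmbOfFin rfl ⟨i + 1, by omega⟩ < s.orderEmbOfFin rfl j :=
        (s.orderEmbOfFin rfl).strictMono (Fin.lt_def.2 hij)
      rw [Fin.lt_def] at h1 h2
      omega)) (by
    have : (⊤ : Submodule F V) ≤ ⨆ i, L (s.orderEmbOfFin rfl i) := by
      rw [← hsup]
      refine Finset.sup_le fun i hi => ?_
      obtain ⟨k, rfl⟩ : i ∈ Set.range (s.orderEmbOfFin rfl) := by simpa using hi
      exact le_iSup (fun k => L (s.orderEmbOfFin rfl k)) k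
    rw [top_le_iff.1 this, finrank_top, hV])
  have hxs : ∀ i ∈ s, x ∈ L i := fun i hi => by
    obtain ⟨k, rfl⟩ : i ∈ Set.range (s.orderEmbOfFin rfl) := by simpa using hi
    exact hx k
  refine ⟨x, hx0, fun j => ?_⟩
  by_contra hxj
  set D := s.filter fun i => ¬ (i.val + 1 < j.val ∨ j.val + 1 < i.val) with hD
  have hjs : j ∉ s := fun hj => hxj (hxs j hj)
  have hDcard : D.card ≤ 2 := by
    rw [← Finset.card_map Fin.valEmbedding]
    refine (Finset.card_le_card (t := {j.val - 1, j.val + 1}) fun k hk => ?_).trans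
      Finset.card_le_two
    obtain ⟨i, hi, rfl⟩ := Finset.mem_map.1 hk
    rw [hD, Finset.mem_filter] at hi
    have : i.val ≠ j.val := fun h => hjs (Fin.ext h ▸ hi.1)
    simp only [Fin.valEmbedding_apply, Finset.mem_insert, Finset.mem_singleton]
    omega
  have hle : (⊤ : Submodule F V) ≤ (F ∙ x ⊔ L j) ⊔ D.sup L := by
    rw [← hsup]
    refine Finset.sup_le fun i hi => ?_
    by_cases hij : i.val + 1 < j.val ∨ j.val + 1 < i.val
    · have : finrank F ↥(L i ⊔ L j) ≤ 3 := by
        rcases hij with hij | hij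
        · exact hLL i j hij
        · exact sup_comm (L i) (L j) ▸ hLL j i hij
      obtain ⟨y, hyi, hyj, hy⟩ := exists_ne_zero_of_finrank_sup (hL i) (hL j) this
      exact (le_span_singleton_sup (hL i) (hxs i hi) hxj hyi hyj hy).trans le_sup_left
    · exact (Finset.le_sup (f := L) (Finset.mem_filter.2 ⟨hi, hij⟩)).trans le_sup_right
  have h1 := Submodule.finrank_mono hle
  have h2 := finrank_sup_finset_sup_le hL (S := F ∙ x ⊔ L j)
    (Submodule.mem_sup_left (Submodule.mem_span_singleton_self x)) hx0 D
    fun i hi => hxs i (Finset.mem_filter.1 hi).1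
  have h3 := finrank_span_singleton_sup_le (L j) x
  rw [finrank_top, hV] at h1
  have := hL j
  omega

end Lines

section Isometries

variable {F V : Type*} [Field F] [AddCommGroup V] [Module F V] {B : LinearMap.BilinForm F V}
open Module

theorem bilin_sub_one_apply_left {S : End F V} (hS : S * S = 1)
    (hSB : ∀ x y, B (S x) (S y) = B x y) (x y : V) : B ((S - 1) x) y = B x ((S - 1) y) := by
  have h : B (S x) y = B x (S y) := by
    rw [← hSB x (S y), ← Module.End.mul_apply S S y, hS, Module.End.one_apply]
  simp [h]

theorem sub_one_mul_self [CharP F 2] {S : End F V} (hS : S * S = 1) : (S - 1) * (S - 1) = 0 := by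
  have h2 : (2 : F) = 0 := CharTwo.two_eq_zero
  have : (S - 1) * (S - 1) = (2 : F) • (1 - S) := by
    rw [two_smul, sub_mul, mul_sub, hS]
    simp only [mul_one, one_mul]
    abel
  rw [this, h2, zero_smul]

theorem bilin_sub_one_apply_sub_one_apply [CharP F 2] {S : End F V} (hS : S * S = 1)
    (hSB : ∀ x y, B (S x) (S y) = B x y) (x y : V) : B ((S - 1) x) ((S - 1) y) = 0 := by
  rw [bilin_sub_one_apply_left hS hSB, ← Module.End.mul_apply, sub_one_mul_self hS]
  simp

theorem finrank_range_sub_one_sup_le [CharP F 2] [FiniteDimensional F V] (hV : finrank F V = 6)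
    (hB : B.Nondegenerate) {S T : End F V}
    (hS : S * S = 1) (hSB : ∀ x y, B (S x) (S y) = B x y) (hT : T * T = 1)
    (hTB : ∀ x y, B (T x) (T y) = B x y) (hST : Commute S T)
    (hSr : finrank F (LinearMap.range (S - 1)) = 2)
    (hTr : finrank F (LinearMap.range (T - 1)) = 2) :
    finrank F ↥(LinearMap.range (S - 1) ⊔ LinearMap.range (T - 1)) ≤ 3 := by
  have hc : (S - 1) * (T - 1) = (T - 1) * (S - 1) :=
    ((hST.sub_left (Commute.one_left _)).sub_right (Commute.one_right _)).eq
  by_cases h0 : (S - 1) * (T - 1) = 0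
  · have hST0 (x y : V) : B ((S - 1) x) ((T - 1) y) = 0 := by
      rw [bilin_sub_one_apply_left hS hSB, ← Module.End.mul_apply, h0]
      simp
    have hTS0 (x y : V) : B ((T - 1) x) ((S - 1) y) = 0 := by
      rw [bilin_sub_one_apply_left hT hTB, ← Module.End.mul_apply, ← hc, h0]
      simp
    have hle : LinearMap.range (S - 1) ⊔ LinearMap.range (T - 1) ≤
        B.orthogonal (LinearMap.range (S - 1) ⊔ LinearMap.range (T - 1)) := by
      intro y hy x hx
      obtain ⟨_, ⟨x₁, rfl⟩, _, ⟨x₂, rfl⟩, rfl⟩ := Submodule.mem_sup.1 hx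
      obtain ⟨_, ⟨y₁, rfl⟩, _, ⟨y₂, rfl⟩, rfl⟩ := Submodule.mem_sup.1 hy
      rw [LinearMap.map_add₂, map_add, map_add, hST0, hTS0,
        bilin_sub_one_apply_sub_one_apply hS hSB, bilin_sub_one_apply_sub_one_apply hT hTB]
      simp
    have h1 := Submodule.finrank_mono hle
    rw [LinearMap.BilinForm.finrank_orthogonal hB, hV] at h1
    omega
  · obtain ⟨x, hx⟩ : ∃ x, ((S - 1) * (T - 1)) x ≠ 0 := by
      by_contra! h
      exact h0 (LinearMap.ext h)
    have h1 : ((S - 1) * (T - 1)) x ∈ LinearMap.range (S - 1) := ⟨_, rfl⟩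
    have h2 : ((S - 1) * (T - 1)) x ∈ LinearMap.range (T - 1) := hc ▸ ⟨_, rfl⟩
    have := finrank_sup_le_of_mem hTr h1 h2 hx
    omega

/-- Commuting relations forbid isometric involutions of a `6`-dimensional space with displacement
of rank two from jointly having full displacement. -/
theorem iSup_range_sub_one_ne_top [CharP F 2] [FiniteDimensional F V] (hV : finrank F V = 6)
    (hB : B.Nondegenerate) {n : ℕ} {T : Fin n → End F V} (hT : ∀ i, T i * T i = 1)
    (hTB : ∀ i x y, B (T i x) (T i y) = B x y)
    (hTT : ∀ i j : Fin n, i.val + 1 < j.val → Commute (T i) (T j))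
    (hTr : ∀ i, finrank F (LinearMap.range (T i - 1)) = 2) :
    ⨆ i, LinearMap.range (T i - 1) ≠ ⊤ := by
  intro htop
  obtain ⟨x, hx0, hx⟩ := exists_common_vector_of_planes hV (fun i => LinearMap.range (T i - 1)) hTr
    (fun i j hij => finrank_range_sub_one_sup_le hV hB (hT i) (hTB i) (hT j) (hTB j) (hTT i j hij)
      (hTr i) (hTr j)) htop
  refine hx0 (hB.1 x fun y => ?_)
  have hle : ⨆ i, LinearMap.range (T i - 1) ≤ LinearMap.ker (B x) := by
    refine iSup_le fun i => ?_
    rintro _ ⟨z, rfl⟩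
    obtain ⟨w, rfl⟩ := hx i
    exact bilin_sub_one_apply_sub_one_apply (hT i) (hTB i) w z
  rw [htop] at hle
  exact hle trivial

end Isometries

section Compound

open Matrix
variable {F : Type*} [Field F]

/-- The `2 × 2` minor on rows `a, b` and columns `c, d`. -/
def minor (g : Matrix (Fin 4) (Fin 4) F) (a b c d : Fin 4) : F := g a c * g b d - g a d * g b c

/-- The smaller entry of the `s`-th pair in `Fin 4`, in lexicographic order. -/
def pairFst : Fin 6 → Fin 4 := ![0, 0, 0, 1, 1, 2]

/-- The larger entry of the `s`-th pair in `Fin 4`, in lexicographic order. -/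
def pairSnd : Fin 6 → Fin 4 := ![1, 2, 3, 2, 3, 3]

/-- The second compound of a `4 × 4` matrix. -/
def compound (g : Matrix (Fin 4) (Fin 4) F) : Matrix (Fin 6) (Fin 6) F :=
  Matrix.of fun s t => minor g (pairFst s) (pairSnd s) (pairFst t) (pairSnd t)

theorem minor_mul (g h : Matrix (Fin 4) (Fin 4) F) (a b c d : Fin 4) :
    minor (g * h) a b c d =
      ∑ t, minor g a b (pairFst t) (pairSnd t) * minor h (pairFst t) (pairSnd t) c d := by
  simp [Fin.sum_univ_six, minor, pairFst, pairSnd, Matrix.mul_apply, Fin.sum_univ_four]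
  ring

theorem compound_mul (g h : Matrix (Fin 4) (Fin 4) F) :
    compound (g * h) = compound g * compound h := by
  ext s t
  rw [Matrix.mul_apply]
  exact minor_mul g h _ _ _ _

theorem compound_one : compound (1 : Matrix (Fin 4) (Fin 4) F) = 1 := by
  ext s t
  fin_cases s <;> fin_cases t <;> simp [compound, minor, pairFst, pairSnd, Matrix.one_apply]

/-- The wedge pairing on the second exterior power of a `4`-dimensional space. -/
def wedgePairing (F : Type*) [Field F] : Matrix (Fin 6) (Fin 6) F :=
  !![0, 0, 0, 0, 0, 1; 0, 0, 0, 0, -1, 0; 0, 0, 0, 1, 0, 0;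
    0, 0, 1, 0, 0, 0; 0, -1, 0, 0, 0, 0; 1, 0, 0, 0, 0, 0]

theorem wedgePairing_mul_self : wedgePairing F * wedgePairing F = 1 := by
  ext s t
  fin_cases s <;> fin_cases t <;> simp [wedgePairing, Matrix.mul_apply, Fin.sum_univ_succ]

theorem transpose_mul_wedgePairing_mul_apply (A : Matrix (Fin 6) (Fin 6) F) (s t : Fin 6) :
    (Aᵀ * wedgePairing F * A) s t = A 0 s * A 5 t - A 1 s * A 4 t + A 2 s * A 3 t +
      A 3 s * A 2 t - A 4 s * A 1 t + A 5 s * A 0 t := by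
  simp [wedgePairing, Matrix.mul_apply, Fin.sum_univ_six]
  ring

theorem transpose_compound_mul_wedgePairing_mul (g : Matrix (Fin 4) (Fin 4) F) :
    (compound g)ᵀ * wedgePairing F * compound g = g.det • wedgePairing F := by
  have hdet : g.det = minor g 0 1 0 1 * minor g 2 3 2 3 - minor g 0 2 0 1 * minor g 1 3 2 3 +
      minor g 0 3 0 1 * minor g 1 2 2 3 + minor g 1 2 0 1 * minor g 0 3 2 3 -
      minor g 1 3 0 1 * minor g 0 2 2 3 + minor g 2 3 0 1 * minor g 0 1 2 3 := by
    simp [Matrix.det_succ_row_zero, Fin.sum_univ_succ, minor,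
      show Fin.succAbove (3 : Fin 4) (2 : Fin 3) = 2 from rfl,
      show Fin.succAbove (2 : Fin 4) (2 : Fin 3) = 3 from rfl,
      show Fin.succAbove (1 : Fin 4) (2 : Fin 3) = 3 from rfl]
    ring
  ext s t
  rw [transpose_mul_wedgePairing_mul_apply, Matrix.smul_apply, hdet]
  fin_cases s <;> fin_cases t <;>
    simp [compound, minor, pairFst, pairSnd, wedgePairing] <;> ring

end Compound

section CompoundRank

open Matrix Module
variable {F : Type*} [Field F]

theorem rank_eq_of_factorization {m k : ℕ} {A : Matrix (Fin m) (Fin m) F}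
    {U Y : Matrix (Fin m) (Fin k) F} {X V : Matrix (Fin k) (Fin m) F} (hA : A = U * V)
    (hX : X * U = 1) (hY : V * Y = 1) : A.rank = k := by
  refine le_antisymm ?_ ?_
  · rw [hA]
    exact (Matrix.rank_mul_le_left U V).trans (Matrix.rank_le_width U)
  · have h : X * A * Y = 1 := by
      rw [hA, ← Matrix.mul_assoc, hX, Matrix.one_mul, hY]
    calc k = (X * A * Y).rank := by rw [h, Matrix.rank_one, Fintype.card_fin]
      _ ≤ (X * A).rank := Matrix.rank_mul_le_left _ _
      _ ≤ A.rank := Matrix.rank_mul_le_right _ _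

/-- A transvection. -/
def normalFormOne (F : Type*) [Field F] : Matrix (Fin 4) (Fin 4) F :=
  !![1, 0, 0, 0; 0, 1, 0, 0; 1, 0, 1, 0; 0, 0, 0, 1]

/-- A unipotent matrix with two Jordan blocks of size two. -/
def normalFormTwo (F : Type*) [Field F] : Matrix (Fin 4) (Fin 4) F :=
  !![1, 0, 1, 0; 0, 1, 0, 1; 0, 0, 1, 0; 0, 0, 0, 1]

theorem rank_compound_normalFormOne_sub_one : (compound (normalFormOne F) - 1).rank = 2 := by
  refine rank_eq_of_factorization (U := !![0, 0; 0, 0; 0, 0; -1, 0; 0, 0; 0, 1])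
    (V := !![1, 0, 0, 0, 0, 0; 0, 0, 1, 0, 0, 0]) (X := !![0, 0, 0, -1, 0, 0; 0, 0, 0, 0, 0, 1])
    (Y := !![1, 0; 0, 0; 0, 1; 0, 0; 0, 0; 0, 0]) ?_ ?_ ?_ <;>
  · ext s t
    fin_cases s <;> fin_cases t <;>
      simp [compound, minor, pairFst, pairSnd, normalFormOne, Matrix.mul_apply, Fin.sum_univ_succ]

theorem rank_compound_normalFormTwo_sub_one : (compound (normalFormTwo F) - 1).rank = 2 := by
  refine rank_eq_of_factorization (U := !![1, 0; 0, 0; 0, 1; 0, -1; 0, 0; 0, 0])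
    (V := !![0, 0, 1, -1, 0, 1; 0, 0, 0, 0, 0, 1]) (X := !![1, 0, 0, 0, 0, 0; 0, 0, 1, 0, 0, 0])
    (Y := !![0, 0; 0, 0; 1, -1; 0, 0; 0, 0; 0, 1]) ?_ ?_ ?_ <;>
  · ext s t
    fin_cases s <;> fin_cases t <;>
      simp [compound, minor, pairFst, pairSnd, normalFormTwo, Matrix.mul_apply, Fin.sum_univ_succ]

theorem rank_compound_sub_one_eq_of_conj {a P M : Matrix (Fin 4) (Fin 4) F} (hP : IsUnit P)
    (h : a * P = P * M) : (compound a - 1).rank = (compound M - 1).rank := by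
  obtain ⟨P, rfl⟩ := hP
  have hu : IsUnit (compound (P : Matrix (Fin 4) (Fin 4) F)).det := by
    rw [← Matrix.isUnit_iff_isUnit_det]
    refine IsUnit.of_mul_eq_one (compound (↑P⁻¹ : Matrix (Fin 4) (Fin 4) F)) ?_
    rw [← compound_mul, Units.mul_inv, compound_one]
  rw [← Matrix.rank_mul_eq_left_of_isUnit_det _ (compound a - 1) hu,
    ← Matrix.rank_mul_eq_right_of_isUnit_det _ (compound M - 1) hu, sub_mul, mul_sub,
    ← compound_mul, ← compound_mul, h, one_mul, mul_one]

theorem exists_conj_normalFormTwo {a : Matrix (Fin 4) (Fin 4) F} {f : End F (Fin 4 → F)}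
    (ha : ∀ x, a *ᵥ x = x + f x) (hf : ∀ x, f (f x) = 0) {v w : Fin 4 → F}
    (hvw : LinearIndependent F ![f v, f w]) :
    ∃ P : Matrix (Fin 4) (Fin 4) F, IsUnit P ∧ a * P = P * normalFormTwo F := by
  have hP : LinearIndependent F ![f v, f w, v, w] := by
    rw [LinearIndependent.pair_iff] at hvw
    rw [Fintype.linearIndependent_iff]
    intro g hg
    simp only [Fin.sum_univ_four, Matrix.cons_val] at hg
    have h := congrArg f hg
    simp only [map_add, map_smul, hf, smul_zero, zero_add, map_zero] at h
    obtain ⟨h2, h3⟩ := hvw _ _ h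
    rw [h2, h3, zero_smul, zero_smul, add_zero, add_zero] at hg
    obtain ⟨h0, h1⟩ := hvw _ _ hg
    intro i
    fin_cases i <;> assumption
  refine ⟨(Matrix.of ![f v, f w, v, w])ᵀ, Matrix.linearIndependent_cols_iff_isUnit.1 hP, ?_⟩
  ext i j
  have hj (x : Fin 4 → F) := congrFun (ha x) i
  rw [Matrix.mul_apply]
  simp only [Matrix.mulVec, dotProduct, Pi.add_apply] at hj
  fin_cases j <;>
    simp [normalFormTwo, Matrix.mul_apply, Fin.sum_univ_four] at hj ⊢ <;> simp [hj, hf, add_comm]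

theorem exists_conj_normalFormOne {a : Matrix (Fin 4) (Fin 4) F} {f : End F (Fin 4 → F)}
    (ha : ∀ x, a *ᵥ x = x + f x) (hf : ∀ x, f (f x) = 0) {v : Fin 4 → F} (hv : f v ≠ 0)
    (hrange : ∀ x, f x ∈ F ∙ f v) :
    ∃ P : Matrix (Fin 4) (Fin 4) F, IsUnit P ∧ a * P = P * normalFormOne F := by
  have hker : 3 ≤ finrank F (LinearMap.ker f) := by
    have h1 : LinearMap.range f ≤ F ∙ f v := by
      rintro _ ⟨x, rfl⟩
      exact hrange x
    have h2 := Submodule.finrank_mono h1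
    rw [finrank_span_singleton hv] at h2
    have h3 := f.finrank_range_add_finrank_ker
    rw [Module.finrank_fin_fun] at h3
    omega
  obtain ⟨y, hy⟩ := exists_linearIndependent_pair_of_one_lt_finrank (R := F)
    (x := (⟨f v, hf v⟩ : LinearMap.ker f)) (by omega) (fun h => hv (congrArg Subtype.val h))
  obtain ⟨z, hz⟩ := exists_linearIndependent_cons_of_lt_finrank hy (by omega)
  have hz' := hz.map' (LinearMap.ker f).subtype (Submodule.ker_subtype _)
  have hP : LinearIndependent F (![v, z, f v, y] : Fin 4 → Fin 4 → F) := by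
    have : ((LinearMap.ker f).subtype ∘ Fin.cons z ![⟨f v, hf v⟩, y] : Fin 3 → Fin 4 → F) =
        ![(z : Fin 4 → F), f v, y] := by
      ext i
      fin_cases i <;> rfl
    rw [this] at hz'
    refine linearIndependent_finCons.2 ⟨hz', fun h => hv ?_⟩
    have hle : Submodule.span F (Set.range ![(z : Fin 4 → F), f v, y]) ≤ LinearMap.ker f := by
      rw [Submodule.span_le]
      rintro _ ⟨i, rfl⟩
      fin_cases i
      exacts [z.2, hf v, y.2]
    exact hle h
  refine ⟨(Matrix.of ![v, z, f v, y])ᵀ, Matrix.linearIndependent_cols_iff_isUnit.1 hP, ?_⟩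
  have hz0 : f z = 0 := z.2
  have hy0 : f y = 0 := y.2
  ext i j
  have hj (x : Fin 4 → F) := congrFun (ha x) i
  rw [Matrix.mul_apply]
  simp only [Matrix.mulVec, dotProduct, Pi.add_apply] at hj
  fin_cases j <;>
    simp [normalFormOne, Matrix.mul_apply, Fin.sum_univ_four] at hj ⊢ <;> simp [hj, hf, hz0, hy0]

theorem rank_compound_sub_one [CharP F 2] {a : Matrix (Fin 4) (Fin 4) F} (ha : a * a = 1)
    (ha1 : a ≠ 1) : (compound a - 1).rank = 2 := by
  set f : End F (Fin 4 → F) := (a - 1).mulVecLin with hfdef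
  have haf (x : Fin 4 → F) : a *ᵥ x = x + f x := by
    simp [hfdef]
  have hf (x : Fin 4 → F) : f (f x) = 0 := by
    have h2 : (2 : F) = 0 := CharTwo.two_eq_zero
    have : (a - 1) * (a - 1) = (2 : F) • (1 - a) := by
      rw [two_smul, sub_mul, mul_sub, ha]
      simp only [mul_one, one_mul]
      abel
    rw [hfdef, Matrix.mulVecLin_apply, Matrix.mulVecLin_apply, Matrix.mulVec_mulVec, this, h2,
      zero_smul, Matrix.zero_mulVec]
  obtain ⟨v, hv⟩ : ∃ v, f v ≠ 0 := by
    by_contra! h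
    refine ha1 (Matrix.ext_of_mulVec_single fun i => ?_)
    rw [haf, h, add_zero, Matrix.one_mulVec]
  by_cases hrange : ∀ x, f x ∈ F ∙ f v
  · obtain ⟨P, hP, h⟩ := exists_conj_normalFormOne haf hf hv hrange
    rw [rank_compound_sub_one_eq_of_conj hP h, rank_compound_normalFormOne_sub_one]
  · push Not at hrange
    obtain ⟨w, hw⟩ := hrange
    have hvw : LinearIndependent F ![f v, f w] := by
      rw [LinearIndependent.pair_iff' hv]
      exact fun c hc => hw (Submodule.mem_span_singleton.2 ⟨c, hc⟩)
    obtain ⟨P, hP, h⟩ := exists_conj_normalFormTwo haf hf hvw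
    rw [rank_compound_sub_one_eq_of_conj hP h, rank_compound_normalFormTwo_sub_one]

end CompoundRank

section EvenConclusion

open Matrix Module
variable {F : Type*} [Field F]

/-- The subgroup of elements whose second compound acts trivially modulo `R`. -/
def displacementSubgroup (R : Submodule F (Fin 6 → F)) :
    Subgroup (Matrix.SpecialLinearGroup (Fin 4) F) where
  carrier := {g | ∀ x, compound g.1 *ᵥ x - x ∈ R}
  one_mem' x := by simp [compound_one]
  mul_mem' {g h} hg hh x := by
    have := R.add_mem (hg (compound h.1 *ᵥ x)) (hh x)
    rwa [sub_add_sub_cancel, mulVec_mulVec, ← compound_mul] at this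
  inv_mem' {g} hg x := by
    have h := R.neg_mem (hg (compound (g⁻¹).1 *ᵥ x))
    rwa [mulVec_mulVec, ← compound_mul, ← Matrix.SpecialLinearGroup.coe_mul, mul_inv_cancel,
      Matrix.SpecialLinearGroup.coe_one, compound_one, one_mulVec, neg_sub] at h

theorem eq_top_of_displacementSubgroup_eq_top {R : Submodule F (Fin 6 → F)}
    (hR : displacementSubgroup R = ⊤) : R = ⊤ := by
  have hmem {i j : Fin 4} (hij : i ≠ j) {k s : Fin 6}
      (h : compound (Matrix.SpecialLinearGroup.transvection hij (1 : F)).1 *ᵥ Pi.single k 1 =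
        Pi.single k 1 + Pi.single s 1) : (Pi.single s 1 : Fin 6 → F) ∈ R := by
    have ht : Matrix.SpecialLinearGroup.transvection hij (1 : F) ∈ displacementSubgroup R :=
      hR ▸ Subgroup.mem_top _
    have := ht (Pi.single k 1)
    rwa [h, add_sub_cancel_left] at this
  have hall (s : Fin 6) : (Pi.single s 1 : Fin 6 → F) ∈ R := by
    fin_cases s
    on_goal 1 => refine hmem (i := 1) (j := 2) (by decide) (k := 1) ?_
    on_goal 2 => refine hmem (i := 0) (j := 1) (by decide) (k := 3) ?_
    on_goal 3 => refine hmem (i := 0) (j := 1) (by decide) (k := 4) ?_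
    on_goal 4 => refine hmem (i := 1) (j := 0) (by decide) (k := 1) ?_
    on_goal 5 => refine hmem (i := 1) (j := 0) (by decide) (k := 2) ?_
    on_goal 6 => refine hmem (i := 2) (j := 0) (by decide) (k := 2) ?_
    all_goals
      rw [mulVec_single_one]
      ext t
      fin_cases t <;>
        simp [compound, minor, pairFst, pairSnd, Matrix.SpecialLinearGroup.transvection,
          Matrix.transvection, Matrix.single_apply, Matrix.one_apply]
  rw [eq_top_iff, ← (Pi.basisFun F (Fin 6)).span_eq, Submodule.span_le]
  rintro _ ⟨s, rfl⟩
  rw [Pi.basisFun_apply]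
  exact hall s

theorem mk_injective_of_char_two [CharP F 2] {g h : Matrix.SpecialLinearGroup (Fin 4) F}
    (hgh : (g : Matrix.ProjectiveSpecialLinearGroup (Fin 4) F) = h) : g = h := by
  obtain ⟨c, hc⟩ := coe_eq_smul_of_mk_eq_mk hgh
  have hdet := congrArg Matrix.det hc
  rw [Matrix.det_smul, g.2, h.2, mul_one, Fintype.card_fin] at hdet
  have hc1 : (c - 1) ^ 2 ^ 2 = 0 := by
    rw [sub_pow_char_pow, one_pow]
    norm_num
    rw [← hdet, sub_self]
  rw [sub_eq_zero.1 (eq_zero_of_pow_eq_zero hc1), one_smul] at hc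
  exact Subtype.ext hc.symm

theorem wedgePairing_nondegenerate : (Matrix.toBilin' (wedgePairing F)).Nondegenerate := by
  refine LinearMap.BilinForm.nondegenerate_toBilin'_of_det_ne_zero' _ fun h => ?_
  have := congrArg Matrix.det (wedgePairing_mul_self (F := F))
  rw [Matrix.det_mul, h, zero_mul, Matrix.det_one] at this
  exact zero_ne_one this

theorem toBilin'_wedgePairing_compound (g : Matrix.SpecialLinearGroup (Fin 4) F)
    (x y : Fin 6 → F) :
    Matrix.toBilin' (wedgePairing F) (compound g.1 *ᵥ x) (compound g.1 *ᵥ y) =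
      Matrix.toBilin' (wedgePairing F) x y := by
  have h := transpose_compound_mul_wedgePairing_mul g.1
  rw [g.2, one_smul] at h
  simp only [Matrix.toBilin'_apply', mulVec_mulVec]
  conv_rhs => rw [← h, Matrix.mul_assoc, ← mulVec_mulVec, dotProduct_mulVec, vecMul_transpose]

theorem closure_range_ne_top_of_char_two [CharP F 2] {n : ℕ}
    {a : Fin n → Matrix.SpecialLinearGroup (Fin 4) F} (ha : ∀ i, a i * a i = 1)
    (ha1 : ∀ i, a i ≠ 1) (haa : ∀ i j : Fin n, i.val + 1 < j.val → Commute (a i) (a j)) :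
    Subgroup.closure (Set.range a) ≠ ⊤ := by
  intro htop
  have hmul (g h : Matrix.SpecialLinearGroup (Fin 4) F) :
      ((compound g.1).mulVecLin * (compound h.1).mulVecLin : End F (Fin 6 → F)) =
        (compound (g * h).1).mulVecLin := by
    rw [Matrix.SpecialLinearGroup.coe_mul, compound_mul, Matrix.mulVecLin_mul]
    rfl
  have hsub (i : Fin n) : (compound (a i).1).mulVecLin - 1 = (compound (a i).1 - 1).mulVecLin := by
    ext x
    simp
  refine iSup_range_sub_one_ne_top (by simp) wedgePairing_nondegenerate
    (T := fun i => (compound (a i).1).mulVecLin) (fun i => ?_)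
    (fun i => toBilin'_wedgePairing_compound (a i)) (fun i j hij => ?_) (fun i => ?_)
    (eq_top_of_displacementSubgroup_eq_top (top_le_iff.1 ?_))
  · rw [hmul, ha, Matrix.SpecialLinearGroup.coe_one, compound_one, Matrix.mulVecLin_one]
    rfl
  · rw [Commute, SemiconjBy, hmul, hmul, (haa i j hij).eq]
  · rw [hsub]
    exact rank_compound_sub_one (congrArg Subtype.val (ha i)) fun h => ha1 i (Subtype.ext h)
  · rw [← htop, Subgroup.closure_le]
    rintro _ ⟨i, rfl⟩ x
    exact le_iSup (fun i => LinearMap.range ((compound (a i).1).mulVecLin - 1)) i ⟨x, rfl⟩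

theorem closure_range_ne_top_of_even [Fintype F] (hF : Even (Fintype.card F)) {n : ℕ}
    {ρ : Fin n → Matrix.ProjectiveSpecialLinearGroup (Fin 4) F} (hρ : ∀ i, orderOf (ρ i) = 2)
    (hcomm : ∀ i j : Fin n, i.val + 1 < j.val → Commute (ρ i) (ρ j)) :
    Subgroup.closure (Set.range ρ) ≠ ⊤ := by
  have : CharP F 2 := by
    have := FiniteField.even_card_iff_char_two.2 (Nat.even_iff.1 hF)
    exact this ▸ ringChar.charP F
  intro htop
  choose a hmk using fun i => QuotientGroup.mk_surjective (ρ i)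
  obtain rfl : (fun i => (a i : Matrix.ProjectiveSpecialLinearGroup (Fin 4) F)) = ρ := funext hmk
  refine closure_range_ne_top_of_char_two (a := a) (fun i => mk_injective_of_char_two ?_)
    (fun i h => ?_) (fun i j hij => mk_injective_of_char_two (hcomm i j hij)) ?_
  · have := pow_orderOf_eq_one (a i : Matrix.ProjectiveSpecialLinearGroup (Fin 4) F)
    rw [hρ i, pow_two] at this
    exact this
  · have := hρ i
    simp [h] at this
  · refine (Subgroup.eq_top_iff' _).2 fun g => ?_
    have hg : (g : Matrix.ProjectiveSpecialLinearGroup (Fin 4) F) ∈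
        Subgroup.closure ((fun i => (a i : Matrix.ProjectiveSpecialLinearGroup (Fin 4) F)) ''
          Set.univ) := by
      rw [Set.image_univ, htop]
      exact Subgroup.mem_top _
    obtain ⟨g', hg', h⟩ := exists_mem_closure_of_mk_mem_closure hg
    rw [Set.image_univ] at hg'
    exact mk_injective_of_char_two h ▸ hg'

end EvenConclusion

end PSLFour

/-- `PSL(4, q)` has a string C-group representation of rank four when `q` is odd,
and no string C-group representation at all when `q` is even. -/
theorem psl4_stringCGroup (F : Type*) [Field F] [Fintype F] :
    (Odd (Fintype.card F) →
      ∃ ρ : Fin 4 → Matrix.ProjectiveSpecialLinearGroup (Fin 4) F, IsStringCGroupRep ρ) ∧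
    (Even (Fintype.card F) →
      ∀ (n : ℕ) (ρ : Fin n → Matrix.ProjectiveSpecialLinearGroup (Fin 4) F),
        ¬ IsStringCGroupRep ρ) := by
  refine ⟨fun hF => PSLFour.exists_isStringCGroupRep_of_odd hF, fun hF n ρ hρ => ?_⟩
  exact PSLFour.closure_range_ne_top_of_even hF hρ.1 hρ.2.2.1 hρ.2.1
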